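/- (Convergence of minimizers, Corollary 3.3.) One has lim_{N→∞} inf_{π∈𝒫(C([a,b];ℝⁿ))} 𝔸_{μ_a^{(N)},μ_b^{(N)}}(π) = inf_{π∈𝒫(C([a,b];ℝⁿ))} 𝔸_{μ_a,μ_b}(π), and both infima are attained. Moreover, if (π^{(N)}) is a sequence of almost minimizers, i.e. 𝔸_{μ_a^{(N)},μ_b^{(N)}}(π^{(N)}) → inf_π 𝔸_{μ_a,μ_b}(π) as N → ∞, then (π^{(N)}) admits a weakly convergent subsequence, and every weak limit of a subsequence of (π^{(N)}) is a minimizer of 𝔸_{μ_a,μ_b}. -/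

import Mathlib

open MeasureTheory Filter Topology
open scoped ENNReal NNReal

noncomputable section

/-- Euclidean space `ℝⁿ`. -/
abbrev Eu (n : ℕ) := EuclideanSpace ℝ (Fin n)

/-- The space `C([a,b];ℝⁿ)` of continuous curves with the supremum metric. -/
abbrev CPath (a b : ℝ) (n : ℕ) := C(Set.Icc a b, Eu n)

/-- We endow the path space with its Borel σ-algebra. -/
noncomputable instance pathMeasurableSpace (a b : ℝ) (n : ℕ) :
    MeasurableSpace (CPath a b n) := borel _

instance pathBorelSpace (a b : ℝ) (n : ℕ) : BorelSpace (CPath a b n) :=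
  ⟨rfl⟩

/-- Evaluation of a curve at time `t ∈ [a,b]` (junk value `0` outside `[a,b]`). -/
def pev {a b : ℝ} {n : ℕ} (γ : CPath a b n) (t : ℝ) : Eu n :=
  if ht : t ∈ Set.Icc a b then γ ⟨t, ht⟩ else 0

/-- A curve is absolutely continuous if it has a Bochner-integrable derivative `g` with
`γ t = γ s + ∫_s^t g`. -/
def IsACC {a b : ℝ} {n : ℕ} (γ : CPath a b n) : Prop :=
  ∃ g : ℝ → Eu n, IntegrableOn g (Set.Icc a b) ∧
    ∀ s t : Set.Icc a b, γ t = γ s + ∫ u in (s : ℝ)..(t : ℝ), g u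

open Classical in
/-- The action `𝒜(γ) = ∫_a^b L(γ(t), γ̇(t)) dt ∈ (−∞,+∞]`, equal to `+∞` on curves that are
not absolutely continuous (and, by the convention that the integral is `+∞` when the
integrand fails to be integrable -- its negative part being automatically integrable --
also on absolutely continuous curves with non-integrable Lagrangian). -/
def action {n : ℕ} (L : Eu n → Eu n → ℝ) (a b : ℝ) (γ : CPath a b n) : EReal :=
  if h : IsACC γ then
    (if IntegrableOn (fun t => L (pev γ t) (h.choose t)) (Set.Icc a b) then
      (((∫ t in Set.Icc a b, L (pev γ t) (h.choose t)) : ℝ) : EReal)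
    else ⊤)
  else ⊤

/-- Positive part of an extended real, as `ℝ≥0∞`. -/
def epos (x : EReal) : ℝ≥0∞ := if x = ⊤ then ⊤ else ENNReal.ofReal x.toReal

/-- The integral `∫ F dπ ∈ [−∞,+∞]` of an extended-real-valued function, defined as the
difference of the lower integrals of the positive and negative parts. -/
def mint {X : Type*} [MeasurableSpace X] (F : X → EReal) (π : Measure X) : EReal :=
  ((∫⁻ γ, epos (F γ) ∂π : ℝ≥0∞) : EReal) - ((∫⁻ γ, epos (-(F γ)) ∂π : ℝ≥0∞) : EReal)

open Classical in
/-- The constrained functional `𝔸_{μa,μb}(π) = ∫ 𝒜 dπ` if `pr_a#π = μa` and `pr_b#π = μb`,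
and `+∞` otherwise, for a given (extended-real-valued) action functional `F`. -/
def aFun {a b : ℝ} {n : ℕ} (F : CPath a b n → EReal) (μa μb : Measure (Eu n))
    (π : Measure (CPath a b n)) : EReal :=
  if Measure.map (fun γ => pev γ a) π = μa ∧ Measure.map (fun γ => pev γ b) π = μb then
    mint F π
  else ⊤

/-- Weak convergence of a sequence of measures: convergence of the integrals of all bounded
continuous functions. -/
def WeakLim {X : Type*} [TopologicalSpace X] [MeasurableSpace X]
    (πs : ℕ → Measure X) (π : Measure X) : Prop :=
  ∀ φ : BoundedContinuousFunction X ℝ,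
    Tendsto (fun N => ∫ x, φ x ∂(πs N)) atTop (𝓝 (∫ x, φ x ∂π))

/-- The empirical measure `(1/N) ∑_{i=1}^N δ_{x i}`. -/
def emp {X : Type*} [MeasurableSpace X] (N : ℕ) (x : Fin N → X) : Measure X :=
  (N : ℝ≥0∞)⁻¹ • ∑ i : Fin N, Measure.dirac (x i)

/-- The topological support of a measure. -/
def msupp {α : Type*} [TopologicalSpace α] [MeasurableSpace α] (μ : Measure α) : Set α :=
  {x | ∀ U : Set α, IsOpen U → x ∈ U → 0 < μ U}

/-- The set `Γ^min_{K₁,K₂}` of minimizing extremals starting in `K₁` and ending in `K₂`. -/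
def GammaMin {n : ℕ} (L : Eu n → Eu n → ℝ) (a b : ℝ) (K₁ K₂ : Set (Eu n)) :
    Set (CPath a b n) :=
  {γ | IsACC γ ∧ pev γ a ∈ K₁ ∧ pev γ b ∈ K₂ ∧
    ∀ γ' : CPath a b n, IsACC γ' → pev γ' a = pev γ a → pev γ' b = pev γ b →
      action L a b γ ≤ action L a b γ'}

/-- The Lagrangian cost `c(x,y)`: the minimal action among absolutely continuous curves
from `x` to `y`. -/
def cost {n : ℕ} (L : Eu n → Eu n → ℝ) (a b : ℝ) (x y : Eu n) : EReal :=
  ⨅ γ ∈ {γ : CPath a b n | IsACC γ ∧ pev γ a = x ∧ pev γ b = y}, action L a b γ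

/-- The restriction of a continuous curve `ℝ → ℝⁿ` to `[a,b]` as an element of the path
space. -/
def toPath {n : ℕ} (a b : ℝ) (f : ℝ → Eu n) (hf : Continuous f) : CPath a b n :=
  (ContinuousMap.mk f hf).restrict (Set.Icc a b)

/-- `Φ : ℝⁿ × ℝⁿ → C([a,b];ℝⁿ)` is the Euler–Lagrange (Newton) flow map for the Lagrangian
`L(x,v) = (m/2)|v|² − V(x)`: it is continuous and `Φ(x,v)` is a `C²` solution of
`m γ'' = −∇V(γ)` with initial position `x` and initial velocity `v`. -/
def IsNewtonFlow {n : ℕ} (m : ℝ) (V : Eu n → ℝ) (a b : ℝ)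
    (Φ : Eu n × Eu n → CPath a b n) : Prop :=
  Continuous Φ ∧ ∀ x v : Eu n, ∃ f : ℝ → Eu n, ContDiff ℝ 2 f ∧
    (∀ t : Set.Icc a b, Φ (x, v) t = f t) ∧ f a = x ∧ deriv f a = v ∧
    ∀ t ∈ Set.Icc a b, m • deriv (deriv f) t = -gradient V (f t)

/-- The set of `C²` solutions of `m γ'' = −∇V(γ)` starting in `Ka` and ending in `Kb`,
viewed as a subset of the path space. -/
def NewtonSet {n : ℕ} (m : ℝ) (V : Eu n → ℝ) (a b : ℝ) (Ka Kb : Set (Eu n)) :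
    Set (CPath a b n) :=
  {γ | ∃ f : ℝ → Eu n, ContDiff ℝ 2 f ∧ (∀ t : Set.Icc a b, γ t = f t) ∧
    (∀ t ∈ Set.Icc a b, m • deriv (deriv f) t = -gradient V (f t)) ∧
    f a ∈ Ka ∧ f b ∈ Kb}

/-- `γ` is piecewise affine subordinate to the partition `a = τ₀ < … < τ_l = b`. -/
def PiecewiseAffine {n : ℕ} (a b : ℝ) (τ : ℕ → ℝ) (l : ℕ) (γ : CPath a b n) : Prop :=
  ∀ j < l, ∀ t : Set.Icc a b, (t : ℝ) ∈ Set.Icc (τ j) (τ (j + 1)) →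
    γ t = pev γ (τ j) + (((t : ℝ) - τ j) / (τ (j + 1) - τ j)) •
      (pev γ (τ (j + 1)) - pev γ (τ j))

/-- `IsPartition a b τ l h`: `a = τ₀ < τ₁ < … < τ_l = b` is a partition of `[a,b]` of mesh
at most `h`. -/
def IsPartition (a b : ℝ) (τ : ℕ → ℝ) (l : ℕ) (h : ℝ) : Prop :=
  1 ≤ l ∧ τ 0 = a ∧ τ l = b ∧ (∀ j < l, τ j < τ (j + 1)) ∧
    ∀ j < l, τ (j + 1) - τ j ≤ h

/-- The midpoint-rule discrete action, as a (real-valued) sum over the first `l` intervals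
of the partition. -/
def dActionSum {n : ℕ} (m : ℝ) (V : Eu n → ℝ) {a b : ℝ} (τ : ℕ → ℝ) (l : ℕ)
    (γ : CPath a b n) : ℝ :=
  ∑ j ∈ Finset.range l,
    (m / 2 * ‖pev γ (τ (j + 1)) - pev γ (τ j)‖ ^ 2 / (τ (j + 1) - τ j) -
      V ((2 : ℝ)⁻¹ • (pev γ (τ (j + 1)) + pev γ (τ j))) * (τ (j + 1) - τ j))

open Classical in
/-- The discrete action `𝒜^{[h]}`: the midpoint-rule discrete action for piecewise affine
curves subordinate to the partition, `+∞` otherwise. -/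
def dAction {n : ℕ} (m : ℝ) (V : Eu n → ℝ) (a b : ℝ) (τ : ℕ → ℝ) (l : ℕ)
    (γ : CPath a b n) : EReal :=
  if PiecewiseAffine a b τ l γ then ((dActionSum m V τ l γ : ℝ) : EReal) else ⊤

/-- The discrete Euler–Lagrange equations for a piecewise affine curve subordinate to the
partition `a = τ₀ < … < τ_l = b`. -/
def DiscreteEL {n : ℕ} (m : ℝ) (V : Eu n → ℝ) {a b : ℝ} (τ : ℕ → ℝ) (l : ℕ)
    (γ : CPath a b n) : Prop :=
  ∀ j, 1 ≤ j → j < l →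
    m • ((τ j - τ (j - 1))⁻¹ • (pev γ (τ j) - pev γ (τ (j - 1)))) -
      m • ((τ (j + 1) - τ j)⁻¹ • (pev γ (τ (j + 1)) - pev γ (τ j))) =
    ((τ j - τ (j - 1)) / 2) • gradient V ((2 : ℝ)⁻¹ • (pev γ (τ (j - 1)) + pev γ (τ j))) +
      ((τ (j + 1) - τ j) / 2) • gradient V ((2 : ℝ)⁻¹ • (pev γ (τ j) + pev γ (τ (j + 1))))

end

section Lagrangian

variable {n : ℕ} {L : Eu n → Eu n → ℝ}

theorem contDiff_velocity (hL1 : ContDiff ℝ (⊤ : ℕ∞) (Function.uncurry L)) (x : Eu n) :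
    ContDiff ℝ (⊤ : ℕ∞) (L x) :=
  hL1.comp (contDiff_const.prodMk contDiff_id)

theorem continuous_fderiv_velocity (hL1 : ContDiff ℝ (⊤ : ℕ∞) (Function.uncurry L)) :
    Continuous (fun p : Eu n × Eu n => fderiv ℝ (L p.1) p.2) := by
  have h : ContDiff ℝ 0 (fun p : Eu n × Eu n => fderiv ℝ (L p.1) p.2) := by
    refine ContDiff.fderiv (m := 1) (n := 0) (f := fun p : Eu n × Eu n => L p.1)
      (g := fun p => p.2) ?_ contDiff_snd (by simp)
    have h1 : ContDiff ℝ 1 (Function.uncurry L) := hL1.of_le (by exact_mod_cast le_top)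
    exact h1.comp ((contDiff_fst.comp contDiff_fst).prodMk contDiff_snd)
  exact h.continuous

/-- Second-order lower bound for a Lagrangian whose velocity Hessian is bounded below. -/
theorem taylor_lower_bound (hL1 : ContDiff ℝ (⊤ : ℕ∞) (Function.uncurry L)) {x : Eu n} {c₀ : ℝ}
    (hc : ∀ v w : Eu n, c₀ * ‖w‖ ^ 2 ≤ fderiv ℝ (fderiv ℝ (L x)) v w w) (v w : Eu n) :
    L x v + fderiv ℝ (L x) v w + c₀ / 2 * ‖w‖ ^ 2 ≤ L x (v + w) := by
  have hs := contDiff_velocity hL1 x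
  have hd : Differentiable ℝ (L x) := hs.differentiable (by simp)
  have hd' : Differentiable ℝ (fderiv ℝ (L x)) :=
    (hs.fderiv_right (m := 1) (by norm_cast)).differentiable (by simp)
  have hline : ∀ s : ℝ, HasDerivAt (fun s : ℝ => v + s • w) w s := fun s => by
    simpa using ((hasDerivAt_id s).smul_const w).const_add v
  have hf : ∀ s : ℝ, HasDerivAt (fun s : ℝ => L x (v + s • w)) (fderiv ℝ (L x) (v + s • w) w) s :=
    fun s => (hd _).hasFDerivAt.comp_hasDerivAt s (hline s)
  have hf' : ∀ s : ℝ, HasDerivAt (fun s : ℝ => fderiv ℝ (L x) (v + s • w) w)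
      (fderiv ℝ (fderiv ℝ (L x)) (v + s • w) w w) s := fun s => by
    have := (hd' _).hasFDerivAt.comp_hasDerivAt s (hline s)
    simpa using this.clm_apply (hasDerivAt_const s w)
  set d := fderiv ℝ (L x) v w with hdef
  have hk : Monotone (fun s : ℝ => fderiv ℝ (L x) (v + s • w) w - c₀ * ‖w‖ ^ 2 * s) := by
    have hk' : ∀ s : ℝ, HasDerivAt
        (fun s : ℝ => fderiv ℝ (L x) (v + s • w) w - c₀ * ‖w‖ ^ 2 * s)
        (fderiv ℝ (fderiv ℝ (L x)) (v + s • w) w w - c₀ * ‖w‖ ^ 2) s := fun s => by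
      have := (hf' s).sub ((hasDerivAt_id s).const_mul (c₀ * ‖w‖ ^ 2))
      rw [mul_one] at this
      exact this
    refine monotone_of_deriv_nonneg (fun s => (hk' s).differentiableAt) fun s => ?_
    rw [(hk' s).deriv]
    linarith [hc (v + s • w) w]
  have hh : ∀ s : ℝ, HasDerivAt
      (fun s : ℝ => L x (v + s • w) - s * d - c₀ / 2 * ‖w‖ ^ 2 * s ^ 2)
      (fderiv ℝ (L x) (v + s • w) w - d - c₀ * ‖w‖ ^ 2 * s) s := fun s => by
    have := ((hf s).sub ((hasDerivAt_id s).mul_const d)).sub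
      ((hasDerivAt_pow 2 s).const_mul (c₀ / 2 * ‖w‖ ^ 2))
    refine HasDerivAt.congr_deriv (f := fun s : ℝ => L x (v + s • w) - s * d -
      c₀ / 2 * ‖w‖ ^ 2 * s ^ 2) this ?_
    norm_num
    ring
  have hm : MonotoneOn (fun s : ℝ => L x (v + s • w) - s * d - c₀ / 2 * ‖w‖ ^ 2 * s ^ 2)
      (Set.Ici 0) := by
    refine monotoneOn_of_deriv_nonneg (convex_Ici 0)
      (fun s _ => (hh s).continuousAt.continuousWithinAt)
      (fun s _ => (hh s).differentiableAt.differentiableWithinAt) fun s hs => ?_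
    rw [(hh s).deriv]
    have h0 : (0 : ℝ) ≤ s := by
      rw [interior_Ici] at hs
      exact le_of_lt hs
    have := hk h0
    simp at this
    linarith
  have := hm (Set.mem_Ici.2 le_rfl) (Set.mem_Ici.2 zero_le_one) zero_le_one
  simp at this
  linarith

end Lagrangian

/-- `Reach L x y T A`: some absolutely continuous curve leads from `x` to `y` in time `T` with
(finite) action `A`. -/
def Reach {n : ℕ} (L : Eu n → Eu n → ℝ) (x y : Eu n) (T A : ℝ) : Prop :=
  0 ≤ T ∧ ∃ g : ℝ → Eu n, IntervalIntegrable g volume 0 T ∧ x + ∫ u in (0 : ℝ)..T, g u = y ∧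
    IntervalIntegrable (fun t => L (x + ∫ u in (0 : ℝ)..t, g u) (g t)) volume 0 T ∧
    ∫ t in (0 : ℝ)..T, L (x + ∫ u in (0 : ℝ)..t, g u) (g t) = A

section Reach

variable {n : ℕ} {L : Eu n → Eu n → ℝ} {x y z : Eu n} {T S A B : ℝ}

theorem reach_line (hL : Continuous (Function.uncurry L)) (x v : Eu n) (hT : 0 ≤ T) :
    Reach L x (x + T • v) T (∫ t in (0 : ℝ)..T, L (x + t • v) v) := by
  refine ⟨hT, fun _ => v, intervalIntegrable_const, by simp, ?_, by simp⟩
  have : Continuous fun t : ℝ => L (x + t • v) v :=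
    hL.comp (f := fun t : ℝ => (x + t • v, v)) (by fun_prop)
  simpa using this.intervalIntegrable 0 T

/-- Travelling along a segment costs at most `M * T` if `L ≤ M` along it. -/
theorem reach_segment (hL : Continuous (Function.uncurry L)) {M : ℝ} (hT : 0 < T)
    (hM : ∀ t ∈ Set.Icc 0 T, L (x + t • (T⁻¹ • (y - x))) (T⁻¹ • (y - x)) ≤ M) :
    ∃ A ≤ M * T, Reach L x y T A := by
  have h := reach_line hL x (T⁻¹ • (y - x)) hT.le
  rw [smul_inv_smul₀ hT.ne', add_sub_cancel] at h
  refine ⟨_, ?_, h⟩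
  have hc : Continuous fun t : ℝ => L (x + t • (T⁻¹ • (y - x))) (T⁻¹ • (y - x)) :=
    hL.comp (f := fun t : ℝ => (x + t • (T⁻¹ • (y - x)), T⁻¹ • (y - x))) (by fun_prop)
  calc _ ≤ ∫ _ in (0 : ℝ)..T, M :=
        intervalIntegral.integral_mono_on hT.le (hc.intervalIntegrable 0 T)
          intervalIntegrable_const hM
    _ = M * T := by simp [mul_comm]

/-- Sub-arcs of a curve with integrable velocity and Lagrangian. -/
theorem reach_arc {g : ℝ → Eu n} {a b s t : ℝ} (hg : IntervalIntegrable g volume a b)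
    (hl : IntervalIntegrable (fun t => L (x + ∫ u in a..t, g u) (g t)) volume a b)
    (has : a ≤ s) (hst : s ≤ t) (htb : t ≤ b) :
    Reach L (x + ∫ u in a..s, g u) (x + ∫ u in a..t, g u) (t - s)
      (∫ r in s..t, L (x + ∫ u in a..r, g u) (g r)) := by
  have hsub : ∀ {p q : ℝ}, a ≤ p → p ≤ q → q ≤ b → Set.uIcc p q ⊆ Set.uIcc a b := by
    intro p q h1 h2 h3
    rw [Set.uIcc_of_le h2, Set.uIcc_of_le (h1.trans (h2.trans h3))]
    exact Set.Icc_subset_Icc h1 h3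
  have key : ∀ r ∈ Set.Icc 0 (t - s),
      x + (∫ u in a..s, g u) + ∫ u in (0 : ℝ)..r, g (u + s) = x + ∫ u in a..(r + s), g u := by
    intro r hr
    rw [intervalIntegral.integral_comp_add_right, zero_add, add_assoc,
      intervalIntegral.integral_add_adjacent_intervals]
    · exact hg.mono_set (hsub le_rfl has (hst.trans htb))
    · exact hg.mono_set (hsub has (by linarith [hr.1]) (by linarith [hr.2]))
  have h0 : (0 : ℝ) ≤ t - s := sub_nonneg.2 hst
  refine ⟨h0, fun u => g (u + s), ?_, ?_, ?_, ?_⟩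
  · have := (hg.mono_set (hsub has hst htb)).comp_add_right s
    simpa using this
  · rw [key _ ⟨h0, le_rfl⟩, sub_add_cancel]
  · have := (hl.mono_set (hsub has hst htb)).comp_add_right s
    rw [sub_self] at this
    refine this.congr ?_
    intro r hr
    rw [Set.uIoc_of_le h0] at hr
    simp only
    rw [key r ⟨hr.1.le, hr.2⟩]
  · have := intervalIntegral.integral_comp_add_right (a := 0) (b := t - s)
      (fun r => L (x + ∫ u in a..r, g u) (g r)) s
    rw [zero_add, sub_add_cancel] at this
    rw [← this]
    refine intervalIntegral.integral_congr fun r hr => ?_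
    rw [Set.uIcc_of_le h0] at hr
    simp only
    rw [key r hr]

theorem Reach.trans (h₁ : Reach L x y T A) (h₂ : Reach L y z S B) :
    Reach L x z (T + S) (A + B) := by
  obtain ⟨hT, g₁, hg₁, rfl, hl₁, rfl⟩ := h₁
  obtain ⟨hS, g₂, hg₂, rfl, hl₂, rfl⟩ := h₂
  have hTS : T ≤ T + S := le_add_of_nonneg_right hS
  set g : ℝ → Eu n := fun t => if t ≤ T then g₁ t else g₂ (t - T) with hg
  have e₁ : ∀ {t}, t ≤ T → g t = g₁ t := fun h => if_pos h
  have e₂ : ∀ {t}, T < t → g t = g₂ (t - T) := fun h => if_neg (not_le.2 h)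
  have i₁ : ∀ t ∈ Set.Icc 0 T, ∫ u in (0 : ℝ)..t, g u = ∫ u in (0 : ℝ)..t, g₁ u := by
    intro t ht
    refine intervalIntegral.integral_congr fun u hu => ?_
    rw [Set.uIcc_of_le ht.1] at hu
    exact e₁ (hu.2.trans ht.2)
  have hgi₁ : IntervalIntegrable g volume 0 T := by
    refine hg₁.congr fun u hu => ?_
    rw [Set.uIoc_of_le hT] at hu
    exact (e₁ hu.2).symm
  have hgi₂ : IntervalIntegrable g volume T (T + S) := by
    have := hg₂.comp_sub_right T
    rw [zero_add, add_comm S T] at this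
    refine this.congr fun u hu => ?_
    rw [Set.uIoc_of_le hTS] at hu
    exact (e₂ hu.1).symm
  have i₂ : ∀ t ∈ Set.Icc 0 S,
      ∫ u in (0 : ℝ)..(t + T), g u = (∫ u in (0 : ℝ)..T, g₁ u) + ∫ u in (0 : ℝ)..t, g₂ u := by
    intro t ht
    have hsub : Set.uIcc T (t + T) ⊆ Set.uIcc T (T + S) := by
      rw [Set.uIcc_of_le (by linarith [ht.1]), Set.uIcc_of_le hTS]
      exact Set.Icc_subset_Icc le_rfl (by linarith [ht.2])
    rw [← intervalIntegral.integral_add_adjacent_intervals hgi₁ (hgi₂.mono_set hsub),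
      i₁ T ⟨hT, le_rfl⟩]
    congr 1
    have := intervalIntegral.integral_comp_sub_right (a := T) (b := t + T) g₂ T
    rw [sub_self, add_sub_cancel_right] at this
    rw [← this]
    refine intervalIntegral.integral_congr_ae (ae_of_all _ fun u hu => ?_)
    rw [Set.uIoc_of_le (by linarith [ht.1])] at hu
    exact e₂ hu.1
  set ℓ : ℝ → ℝ := fun t => L (x + ∫ u in (0 : ℝ)..t, g u) (g t) with hℓ
  set ℓ₂ : ℝ → ℝ := fun t =>
    L (x + (∫ u in (0 : ℝ)..T, g₁ u) + ∫ u in (0 : ℝ)..t, g₂ u) (g₂ t) with hℓ₂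
  have f₁ : ∀ t ∈ Set.Icc 0 T, ℓ t = L (x + ∫ u in (0 : ℝ)..t, g₁ u) (g₁ t) := by
    intro t ht
    simp only [hℓ, i₁ t ht, e₁ ht.2]
  have f₂ : ∀ t ∈ Set.Ioc T (T + S), ℓ t = ℓ₂ (t - T) := by
    intro t ht
    have := i₂ (t - T) ⟨by linarith [ht.1], by linarith [ht.2]⟩
    rw [sub_add_cancel] at this
    simp only [hℓ, hℓ₂, this, e₂ ht.1, add_assoc]
  have hli₁ : IntervalIntegrable ℓ volume 0 T := by
    refine hl₁.congr fun u hu => ?_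
    rw [Set.uIoc_of_le hT] at hu
    exact (f₁ u ⟨hu.1.le, hu.2⟩).symm
  have hli₂ : IntervalIntegrable ℓ volume T (T + S) := by
    have := hl₂.comp_sub_right T
    rw [zero_add, add_comm S T] at this
    refine this.congr fun u hu => ?_
    rw [Set.uIoc_of_le hTS] at hu
    exact (f₂ u hu).symm
  refine ⟨add_nonneg hT hS, g, hgi₁.trans hgi₂, ?_, hli₁.trans hli₂, ?_⟩
  · rw [add_comm T S, i₂ S ⟨hS, le_rfl⟩, add_assoc]
  · rw [← intervalIntegral.integral_add_adjacent_intervals hli₁ hli₂]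
    congr 1
    · refine intervalIntegral.integral_congr fun u hu => ?_
      rw [Set.uIcc_of_le hT] at hu
      exact f₁ u hu
    · have := intervalIntegral.integral_comp_sub_right (a := T) (b := T + S) ℓ₂ T
      rw [sub_self, add_sub_cancel_left] at this
      rw [← this]
      refine intervalIntegral.integral_congr_ae (ae_of_all _ fun u hu => ?_)
      rw [Set.uIoc_of_le hTS] at hu
      exact f₂ u hu

theorem Reach.dist_le {c₁ c₂ : ℝ} (hc₁ : 0 < c₁) (hL3 : ∀ x v : Eu n, c₁ * ‖v‖ - c₂ ≤ L x v)
    (h : Reach L x y T A) : c₁ * ‖y - x‖ ≤ A + c₂ * T := by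
  obtain ⟨hT, g, hg, rfl, hl, rfl⟩ := h
  have h1 : ‖∫ u in (0 : ℝ)..T, g u‖ ≤ ∫ u in (0 : ℝ)..T, ‖g u‖ :=
    intervalIntegral.norm_integral_le_integral_norm hT
  have h2 : ∫ u in (0 : ℝ)..T, (c₁ * ‖g u‖ - c₂) ≤
      ∫ t in (0 : ℝ)..T, L (x + ∫ u in (0 : ℝ)..t, g u) (g t) :=
    intervalIntegral.integral_mono_on hT
      ((hg.norm.const_mul c₁).sub intervalIntegrable_const) hl fun t _ => hL3 _ _
  rw [intervalIntegral.integral_sub (hg.norm.const_mul c₁) intervalIntegrable_const,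
    intervalIntegral.integral_const_mul, intervalIntegral.integral_const] at h2
  simp only [sub_zero, smul_eq_mul] at h2
  rw [add_sub_cancel_left]
  nlinarith [mul_le_mul_of_nonneg_left h1 hc₁.le]

theorem Reach.lower_bound {c₁ c₂ : ℝ} (hc₁ : 0 < c₁)
    (hL3 : ∀ x v : Eu n, c₁ * ‖v‖ - c₂ ≤ L x v) (h : Reach L x y T A) : -(c₂ * T) ≤ A := by
  have := h.dist_le hc₁ hL3
  nlinarith [mul_nonneg hc₁.le (norm_nonneg (y - x))]

/-- Cutting a curve into `k` arcs of equal duration, one of them uses at most the mean action. -/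
theorem Reach.exists_cheap_arc (h : Reach L x y T A) {k : ℕ} (hk : 1 ≤ k) :
    ∃ p q s r A₁ A₂ A₃, s + T / k + r = T ∧ A₁ + A₂ + A₃ = A ∧ A₂ ≤ A / k ∧
      Reach L x p s A₁ ∧ Reach L p q (T / k) A₂ ∧ Reach L q y r A₃ := by
  obtain ⟨hT, g, hg, rfl, hl, rfl⟩ := h
  have hk0 : (0 : ℝ) < k := by exact_mod_cast hk
  set ℓ : ℝ → ℝ := fun t => L (x + ∫ u in (0 : ℝ)..t, g u) (g t) with hℓ
  set δ : ℝ := T / k with hδ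
  have hkδ : (k : ℝ) * δ = T := by rw [hδ]; field_simp
  have hδ0 : 0 ≤ δ := div_nonneg hT hk0.le
  have hmem : ∀ i : ℕ, i < k → 0 ≤ (i : ℝ) * δ ∧ (i : ℝ) * δ ≤ ((i + 1 : ℕ) : ℝ) * δ ∧
      ((i + 1 : ℕ) : ℝ) * δ ≤ T := by
    intro i hi
    refine ⟨by positivity, by gcongr; simp, ?_⟩
    rw [← hkδ]
    gcongr
    omega
  have hli : ∀ i < k, IntervalIntegrable ℓ volume ((i : ℝ) * δ) (((i + 1 : ℕ) : ℝ) * δ) := by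
    intro i hi
    obtain ⟨h1, h2, h3⟩ := hmem i hi
    refine hl.mono_set ?_
    rw [Set.uIcc_of_le h2, Set.uIcc_of_le hT]
    exact Set.Icc_subset_Icc h1 h3
  have hsum := intervalIntegral.sum_integral_adjacent_intervals
    (a := fun i : ℕ => (i : ℝ) * δ) hli
  simp only [Nat.cast_zero, zero_mul, hkδ] at hsum
  obtain ⟨i, hi, hle⟩ : ∃ i ∈ Finset.range k,
      ∫ t in ((i : ℝ) * δ)..(((i + 1 : ℕ) : ℝ) * δ), ℓ t ≤ (∫ t in (0 : ℝ)..T, ℓ t) / k := by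
    refine Finset.exists_le_of_sum_le ⟨0, Finset.mem_range.2 hk⟩ ?_
    rw [hsum, Finset.sum_const, Finset.card_range, nsmul_eq_mul, mul_div_cancel₀ _ hk0.ne']
  have hi' := Finset.mem_range.1 hi
  obtain ⟨h1, h2, h3⟩ := hmem i hi'
  have r₁ := reach_arc hg hl le_rfl h1 (h2.trans h3)
  have r₂ := reach_arc hg hl h1 h2 h3
  have r₃ := reach_arc hg hl (h1.trans h2) h3 le_rfl
  have hδ' : ((i + 1 : ℕ) : ℝ) * δ - i * δ = δ := by push_cast; ring
  rw [hδ'] at r₂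
  rw [intervalIntegral.integral_same, add_zero] at r₁
  refine ⟨_, _, _, _, _, _, _, ?_, ?_, hle, r₁, r₂, r₃⟩
  · push_cast
    ring
  · have hsub : ∀ {p q : ℝ}, 0 ≤ p → p ≤ q → q ≤ T → IntervalIntegrable ℓ volume p q := by
      intro p q e1 e2 e3
      refine hl.mono_set ?_
      rw [Set.uIcc_of_le e2, Set.uIcc_of_le hT]
      exact Set.Icc_subset_Icc e1 e3
    rw [intervalIntegral.integral_add_adjacent_intervals (hsub le_rfl h1 (h2.trans h3)) (hli i hi'),
      intervalIntegral.integral_add_adjacent_intervals (hsub le_rfl (h1.trans h2) h3)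
        (hsub (h1.trans h2) h3 le_rfl)]

end Reach

section MinCost

variable {n : ℕ} {L : Eu n → Eu n → ℝ} {x y z : Eu n} {T S A B : ℝ}

theorem exists_reach_segment_bound (hL : Continuous (Function.uncurry L)) (R V : ℝ) :
    ∃ M, 0 ≤ M ∧ ∀ x y : Eu n, ∀ T : ℝ, 0 < T → ‖x‖ ≤ R → ‖y‖ ≤ R → ‖y - x‖ ≤ V * T →
      ∃ A ≤ M * T, Reach L x y T A := by
  obtain ⟨M, hM⟩ := ((isCompact_closedBall (0 : Eu n) R).prod
    (isCompact_closedBall (0 : Eu n) V)).exists_bound_of_continuousOn hL.continuousOn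
  refine ⟨max M 0, le_max_right _ _, fun x y T hT hx hy hxy => reach_segment hL hT fun t ht => ?_⟩
  refine (le_abs_self _).trans ((hM (_, _) ⟨?_, ?_⟩).trans (le_max_left _ _))
  · have hmem := (convex_closedBall (0 : Eu n) R).add_smul_sub_mem
      (mem_closedBall_zero_iff.2 hx) (mem_closedBall_zero_iff.2 hy)
      (t := t * T⁻¹) ⟨mul_nonneg ht.1 (inv_nonneg.2 hT.le), by
        rw [← div_eq_mul_inv]; exact (div_le_one hT).2 ht.2⟩
    rwa [mul_smul] at hmem
  · rw [mem_closedBall_zero_iff, norm_smul, norm_inv, Real.norm_of_nonneg hT.le,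
      inv_mul_le_iff₀ hT, mul_comm]
    exact hxy

/-- The endpoints of a curve may be moved at a cost proportional to the displacement: one gains
time by shortcutting a cheap arc and spends it to reach the new endpoints. -/
theorem exists_perturbation (hL : Continuous (Function.uncurry L)) {c₁ c₂ : ℝ} (hc₁ : 0 < c₁)
    (hc₂ : 0 < c₂) (hL3 : ∀ x v : Eu n, c₁ * ‖v‖ - c₂ ≤ L x v) (hT : 0 < T) (R Amax : ℝ) :
    ∃ C, 0 ≤ C ∧ ∀ k : ℕ, 1 ≤ k → ∀ x y x' y' : Eu n, ∀ A ≤ Amax, ‖x‖ ≤ R → Reach L x y T A →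
      ‖x' - x‖ ≤ T / k / 4 → ‖y' - y‖ ≤ T / k / 4 → ∃ A' ≤ A + C / k, Reach L x' y' T A' := by
  set ℓ : ℝ := (Amax + c₂ * T) / c₁ with hℓ
  obtain ⟨M, hM0, hM⟩ := exists_reach_segment_bound hL (R + ℓ + T) (1 + 2 * ℓ / T)
  refine ⟨(M + c₂) * T, by positivity, fun k hk x y x' y' A hA hx h hxx hyy => ?_⟩
  have hk0 : (1 : ℝ) ≤ k := by exact_mod_cast hk
  have hkpos : (0 : ℝ) < k := by linarith
  obtain ⟨p, q, s, r, A₁, A₂, A₃, hsum, hA3, hA₂, h₁, h₂, h₃⟩ := h.exists_cheap_arc hk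
  have hℓc : c₁ * ℓ = Amax + c₂ * T := by rw [hℓ]; field_simp
  have hdist : ∀ u : Eu n, c₁ * ‖u - x‖ ≤ A + c₂ * T → ‖u - x‖ ≤ ℓ := by
    intro u hu
    refine le_of_mul_le_mul_left ?_ hc₁
    rw [hℓc]
    linarith
  have hy := hdist y (h.dist_le hc₁ hL3)
  have b₁ := h₁.lower_bound hc₁ hL3
  have b₂ := h₂.lower_bound hc₁ hL3
  have b₃ := h₃.lower_bound hc₁ hL3
  set δ : ℝ := T / k with hδ
  have hδ0 : 0 < δ := div_pos hT hkpos
  have hδT : δ ≤ T := div_le_self hT.le hk0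
  have hp := hdist p (by
    have := h₁.dist_le hc₁ hL3
    have e : c₂ * T = c₂ * s + c₂ * δ + c₂ * r := by rw [← hsum]; ring
    linarith)
  have hq := hdist q (by
    have := (h₁.trans h₂).dist_le hc₁ hL3
    have e : c₂ * T = c₂ * (s + δ) + c₂ * r := by rw [← hsum]; ring
    linarith)
  have hℓ0 : 0 ≤ ℓ := (norm_nonneg _).trans hy
  have hpq : ‖q - p‖ ≤ ℓ / k := by
    have := h₂.dist_le hc₁ hL3
    refine le_of_mul_le_mul_left ?_ hc₁
    calc c₁ * ‖q - p‖ ≤ A / k + c₂ * δ := by linarith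
      _ = (A + c₂ * T) / k := by rw [hδ]; ring
      _ ≤ (Amax + c₂ * T) / k := by gcongr
      _ = c₁ * (ℓ / k) := by rw [← hℓc]; ring
  have hnorm : ∀ u v : Eu n, ‖u‖ ≤ ‖v‖ + ‖u - v‖ := fun u v => by
    simpa using norm_add_le v (u - v)
  have hV : δ / 4 ≤ (1 + 2 * ℓ / T) * (δ / 4) :=
    le_mul_of_one_le_left (by positivity) (le_add_of_nonneg_right (by positivity))
  obtain ⟨B₁, hB₁, g₁⟩ := hM x' x (δ / 4) (by positivity) (by linarith [hnorm x' x])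
    (by linarith) (by rw [norm_sub_rev]; exact hxx.trans hV)
  obtain ⟨B₂, hB₂, g₂⟩ := hM p q (δ / 2) (by positivity) (by linarith [hnorm p x])
    (by linarith [hnorm q x]) (by
      refine hpq.trans ?_
      have : (1 + 2 * ℓ / T) * (δ / 2) = δ / 2 + ℓ / k := by rw [hδ]; field_simp
      linarith)
  obtain ⟨B₃, hB₃, g₃⟩ := hM y y' (δ / 4) (by positivity) (by linarith [hnorm y x])
    (by linarith [hnorm y' y, hnorm y x]) (hyy.trans hV)
  refine ⟨B₁ + A₁ + B₂ + A₃ + B₃, ?_, ?_⟩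
  · have : (M + c₂) * T / k = M * (δ / 4) + M * (δ / 2) + M * (δ / 4) + c₂ * δ := by
      rw [hδ]; ring
    linarith
  · have := (((g₁.trans h₁).trans g₂).trans h₃).trans g₃
    have e : δ / 4 + s + δ / 2 + r + δ / 4 = T := by rw [← hsum]; ring
    rwa [e] at this

/-- The minimal action needed to travel from `x` to `y` in time `T`, as a real number. -/
noncomputable def minCost (L : Eu n → Eu n → ℝ) (T : ℝ) (x y : Eu n) : ℝ :=
  sInf {A | Reach L x y T A}

variable {c₁ c₂ : ℝ}

theorem minCost_le (hc₁ : 0 < c₁) (hL3 : ∀ x v : Eu n, c₁ * ‖v‖ - c₂ ≤ L x v)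
    (h : Reach L x y T A) : minCost L T x y ≤ A :=
  csInf_le ⟨-(c₂ * T), fun _ hB => hB.lower_bound hc₁ hL3⟩ h

theorem exists_reach_lt (hL : Continuous (Function.uncurry L)) (hT : 0 < T)
    (h : minCost L T x y < B) : ∃ A < B, Reach L x y T A := by
  have hne : {A | Reach L x y T A}.Nonempty := by
    have := reach_line hL x (T⁻¹ • (y - x)) hT.le
    rw [smul_inv_smul₀ hT.ne', add_sub_cancel] at this
    exact ⟨_, this⟩
  obtain ⟨A, hA, hlt⟩ := exists_lt_of_csInf_lt hne h
  exact ⟨A, hlt, hA⟩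

theorem lower_bound_minCost (hL : Continuous (Function.uncurry L)) (hT : 0 < T) (hc₁ : 0 < c₁)
    (hL3 : ∀ x v : Eu n, c₁ * ‖v‖ - c₂ ≤ L x v) : -(c₂ * T) ≤ minCost L T x y := by
  refine le_of_forall_gt fun B hB => ?_
  obtain ⟨A, hA, h⟩ := exists_reach_lt hL hT hB
  exact (h.lower_bound hc₁ hL3).trans_lt hA

theorem exists_minCost_upper_bound (hL : Continuous (Function.uncurry L)) (hT : 0 < T)
    (hc₁ : 0 < c₁) (hL3 : ∀ x v : Eu n, c₁ * ‖v‖ - c₂ ≤ L x v) (R : ℝ) :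
    ∃ C, ∀ x y : Eu n, ‖x‖ ≤ R → ‖y‖ ≤ R → minCost L T x y ≤ C := by
  obtain ⟨M, -, hM⟩ := exists_reach_segment_bound hL R (2 * R / T)
  refine ⟨M * T, fun x y hx hy => ?_⟩
  obtain ⟨A, hA, h⟩ := hM x y T hT hx hy (by
    rw [div_mul_cancel₀ _ hT.ne']
    linarith [norm_sub_le y x])
  exact (minCost_le hc₁ hL3 h).trans hA

theorem minCost_uniform (hL : Continuous (Function.uncurry L)) (hT : 0 < T)
    (hc₁ : 0 < c₁) (hc₂ : 0 < c₂) (hL3 : ∀ x v : Eu n, c₁ * ‖v‖ - c₂ ≤ L x v) (R : ℝ) {ε : ℝ}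
    (hε : 0 < ε) :
    ∃ δ > 0, ∀ x y x' y' : Eu n, ‖x‖ ≤ R → ‖y‖ ≤ R → ‖x' - x‖ ≤ δ → ‖y' - y‖ ≤ δ →
      minCost L T x' y' ≤ minCost L T x y + ε := by
  obtain ⟨Cm, hCm⟩ := exists_minCost_upper_bound hL hT hc₁ hL3 R
  obtain ⟨C, hC0, hC⟩ := exists_perturbation hL hc₁ hc₂ hL3 hT R (Cm + 1)
  obtain ⟨k, hk⟩ := exists_nat_gt (C / ε)
  have hk0 : (0 : ℝ) < k := (div_nonneg hC0 hε.le).trans_lt hk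
  have hk1 : 1 ≤ k := by exact_mod_cast hk0
  refine ⟨T / k / 4, by positivity, fun x y x' y' hx hy hxx hyy => ?_⟩
  have hCk : C / k ≤ ε := by
    rw [div_le_iff₀ hk0]
    rw [div_lt_iff₀ hε] at hk
    linarith
  refine le_of_forall_pos_le_add fun η hη => ?_
  obtain ⟨A, hA, h⟩ := exists_reach_lt hL hT
    (show minCost L T x y < minCost L T x y + min η 1 by
      have : 0 < min η 1 := lt_min hη one_pos
      linarith)
  obtain ⟨A', hA', h'⟩ := hC k hk1 x y x' y' A
    (by linarith [hCm x y hx hy, min_le_right η 1]) hx h hxx hyy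
  linarith [minCost_le hc₁ hL3 h', min_le_left η 1]

theorem continuous_minCost (hL : Continuous (Function.uncurry L)) (hT : 0 < T)
    (hc₁ : 0 < c₁) (hc₂ : 0 < c₂) (hL3 : ∀ x v : Eu n, c₁ * ‖v‖ - c₂ ≤ L x v) :
    Continuous fun p : Eu n × Eu n => minCost L T p.1 p.2 := by
  refine Metric.continuous_iff.2 fun p ε hε => ?_
  obtain ⟨δ, hδ, h⟩ := minCost_uniform hL hT hc₁ hc₂ hL3 (‖p‖ + 1) (half_pos hε)
  refine ⟨min δ 1, lt_min hδ one_pos, fun q hq => ?_⟩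
  rw [dist_eq_norm] at hq
  have e₁ : ‖q.1 - p.1‖ ≤ min δ 1 := (norm_fst_le (q - p)).trans hq.le
  have e₂ : ‖q.2 - p.2‖ ≤ min δ 1 := (norm_snd_le (q - p)).trans hq.le
  have hnorm : ‖q‖ ≤ ‖p‖ + 1 := by
    have := norm_add_le p (q - p)
    rw [add_sub_cancel] at this
    linarith [min_le_right δ 1]
  have h₁ := h p.1 p.2 q.1 q.2 ((norm_fst_le p).trans (by linarith))
    ((norm_snd_le p).trans (by linarith)) (e₁.trans (min_le_left _ _)) (e₂.trans (min_le_left _ _))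
  have h₂ := h q.1 q.2 p.1 p.2 ((norm_fst_le q).trans hnorm) ((norm_snd_le q).trans hnorm)
    (by rw [norm_sub_rev]; exact e₁.trans (min_le_left _ _))
    (by rw [norm_sub_rev]; exact e₂.trans (min_le_left _ _))
  rw [Real.dist_eq, abs_lt]
  constructor <;> linarith

end MinCost

/-- `g` is a velocity (a.e. derivative) of the curve `γ`. -/
def IsVelocity {a b : ℝ} {n : ℕ} (γ : CPath a b n) (g : ℝ → Eu n) : Prop :=
  IntegrableOn g (Set.Icc a b) ∧
    ∀ s t : Set.Icc a b, γ t = γ s + ∫ u in (s : ℝ)..(t : ℝ), g u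

section Velocity

variable {n : ℕ} {a b : ℝ} {L : Eu n → Eu n → ℝ} {γ : CPath a b n} {g h : ℝ → Eu n}

theorem pev_of_mem {t : ℝ} (ht : t ∈ Set.Icc a b) : pev γ t = γ ⟨t, ht⟩ := dif_pos ht

theorem IsVelocity.intervalIntegrable (hab : a ≤ b) (hg : IsVelocity γ g) :
    IntervalIntegrable g volume a b :=
  (intervalIntegrable_iff_integrableOn_Icc_of_le hab).2 hg.1

theorem IsVelocity.pev_eq (hab : a ≤ b) (hg : IsVelocity γ g) {t : ℝ} (ht : t ∈ Set.Icc a b) :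
    pev γ t = pev γ a + ∫ u in a..t, g u := by
  rw [pev_of_mem ht, pev_of_mem (Set.left_mem_Icc.2 hab)]
  exact hg.2 _ _

theorem isVelocity_of_pev_eq (hab : a ≤ b) (hg : IntegrableOn g (Set.Icc a b))
    (h : ∀ t ∈ Set.Icc a b, pev γ t = pev γ a + ∫ u in a..t, g u) : IsVelocity γ g := by
  have hi : IntervalIntegrable g volume a b :=
    (intervalIntegrable_iff_integrableOn_Icc_of_le hab).2 hg
  have hs : ∀ s ∈ Set.Icc a b, IntervalIntegrable g volume a s := fun s hs =>
    hi.mono_set (by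
      rw [Set.uIcc_of_le hs.1, Set.uIcc_of_le hab]
      exact Set.Icc_subset_Icc_right hs.2)
  refine ⟨hg, fun s t => ?_⟩
  rw [← pev_of_mem s.2, ← pev_of_mem t.2, h _ s.2, h _ t.2, add_assoc,
    intervalIntegral.integral_add_adjacent_intervals (hs _ s.2)
      ((hs _ s.2).symm.trans (hs _ t.2))]

theorem IsVelocity.ae_eq (hab : a ≤ b) (hg : IsVelocity γ g) (hh : IsVelocity γ h) :
    g =ᵐ[volume.restrict (Set.Icc a b)] h := by
  rw [EventuallyEq, ae_restrict_iff' measurableSet_Icc]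
  have ha : ∀ᵐ x : ℝ, x ≠ a := by simp [ae_iff, measure_singleton]
  have hb : ∀ᵐ x : ℝ, x ≠ b := by simp [ae_iff, measure_singleton]
  filter_upwards [(hg.intervalIntegrable hab).ae_hasDerivAt_integral,
    (hh.intervalIntegrable hab).ae_hasDerivAt_integral, ha, hb] with t h1 h2 h3 h4 ht
  rw [Set.uIcc_of_le hab] at h1 h2
  have hl := Set.left_mem_Icc.2 hab
  refine (h1 ht a hl).unique ((h2 ht a hl).congr_of_eventuallyEq ?_)
  filter_upwards [Ioo_mem_nhds (lt_of_le_of_ne ht.1 h3.symm) (lt_of_le_of_ne ht.2 h4)] with s hs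
  have hs' := Set.Ioo_subset_Icc_self hs
  exact add_left_cancel ((hg.pev_eq hab hs').symm.trans (hh.pev_eq hab hs'))

theorem action_eq (hab : a ≤ b) (hg : IsVelocity γ g)
    (hl : IntegrableOn (fun t => L (pev γ t) (g t)) (Set.Icc a b)) :
    action L a b γ = ((∫ t in Set.Icc a b, L (pev γ t) (g t) : ℝ) : EReal) := by
  have hac : IsACC γ := ⟨g, hg⟩
  have hae : (fun t => L (pev γ t) (g t)) =ᵐ[volume.restrict (Set.Icc a b)]
      fun t => L (pev γ t) (hac.choose t) := by
    filter_upwards [hg.ae_eq hab (h := hac.choose) hac.choose_spec] with t ht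
    rw [ht]
  have hl' : IntegrableOn (fun t => L (pev γ t) (hac.choose t)) (Set.Icc a b) :=
    (integrable_congr hae).1 hl
  rw [action, dif_pos hac, if_pos hl', integral_congr_ae hae]

theorem exists_velocity_of_action_ne_top (h : action L a b γ ≠ ⊤) :
    ∃ g, IsVelocity γ g ∧ IntegrableOn (fun t => L (pev γ t) (g t)) (Set.Icc a b) ∧
      action L a b γ = ((∫ t in Set.Icc a b, L (pev γ t) (g t) : ℝ) : EReal) := by
  by_cases hac : IsACC γ
  · by_cases hi : IntegrableOn (fun t => L (pev γ t) (hac.choose t)) (Set.Icc a b)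
    · exact ⟨hac.choose, hac.choose_spec, hi, by rw [action, dif_pos hac, if_pos hi]⟩
    · exact absurd (by rw [action, dif_pos hac, if_neg hi]) h
  · exact absurd (by rw [action, dif_neg hac]) h

theorem action_ne_bot : action L a b γ ≠ ⊥ := by
  unfold action
  split_ifs <;> simp

theorem reach_of_action_eq (hab : a ≤ b) {A : ℝ} (h : action L a b γ = A) :
    Reach L (pev γ a) (pev γ b) (b - a) A := by
  obtain ⟨g, hg, hl, hA⟩ := exists_velocity_of_action_ne_top (h ▸ EReal.coe_ne_top A)
  have hA' : ∫ t in Set.Icc a b, L (pev γ t) (g t) = A := by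
    exact_mod_cast hA.symm.trans h
  have hl' : IntervalIntegrable (fun t => L (pev γ a + ∫ u in a..t, g u) (g t)) volume a b := by
    refine ((intervalIntegrable_iff_integrableOn_Icc_of_le hab).2 hl).congr fun t ht => ?_
    rw [Set.uIoc_of_le hab] at ht
    rw [hg.pev_eq hab (Set.Ioc_subset_Icc_self ht)]
  have := reach_arc (hg.intervalIntegrable hab) hl' le_rfl hab le_rfl
  rw [intervalIntegral.integral_same, add_zero, ← hg.pev_eq hab (Set.right_mem_Icc.2 hab)] at this
  convert this using 1
  rw [← hA', integral_Icc_eq_integral_Ioc, intervalIntegral.integral_of_le hab]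
  refine setIntegral_congr_fun measurableSet_Ioc fun t ht => ?_
  rw [hg.pev_eq hab (Set.Ioc_subset_Icc_self ht)]

theorem Reach.exists_path (hab : a ≤ b) {x y : Eu n} {A : ℝ} (h : Reach L x y (b - a) A) :
    ∃ γ : CPath a b n, pev γ a = x ∧ pev γ b = y ∧ action L a b γ = A := by
  obtain ⟨-, g, hg, hy, hl, hA⟩ := h
  have hg' : IntervalIntegrable (fun u => g (u - a)) volume a b := by
    simpa using hg.comp_sub_right a
  have hl' := hl.comp_sub_right a
  simp only [zero_add, sub_add_cancel] at hl'
  have hcont : ContinuousOn (fun t => x + ∫ u in (0 : ℝ)..(t - a), g u) (Set.Icc a b) := by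
    have h1 := intervalIntegral.continuousOn_primitive_interval' hg' Set.left_mem_uIcc
    rw [Set.uIcc_of_le hab] at h1
    refine ((continuousOn_const (c := x)).add h1).congr fun t _ => ?_
    simp [intervalIntegral.integral_comp_sub_right]
  let γ : CPath a b n := ⟨_, continuousOn_iff_continuous_domRestrict.1 hcont⟩
  have hγ : ∀ t ∈ Set.Icc a b, pev γ t = x + ∫ u in (0 : ℝ)..(t - a), g u := fun t ht =>
    pev_of_mem ht
  have ha : pev γ a = x := by rw [hγ a (Set.left_mem_Icc.2 hab)]; simp
  have hvel : IsVelocity γ (fun u => g (u - a)) := by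
    refine isVelocity_of_pev_eq hab ((intervalIntegrable_iff_integrableOn_Icc_of_le hab).1 hg')
      fun t ht => ?_
    rw [ha, hγ t ht]
    simp [intervalIntegral.integral_comp_sub_right]
  refine ⟨γ, ha, by rw [hγ b (Set.right_mem_Icc.2 hab), hy], ?_⟩
  have hae : ∀ t ∈ Set.Icc a b, L (pev γ t) (g (t - a)) =
      L (x + ∫ u in (0 : ℝ)..(t - a), g u) (g (t - a)) := fun t ht => by rw [hγ t ht]
  rw [action_eq hab hvel, setIntegral_congr_fun measurableSet_Icc hae,
    integral_Icc_eq_integral_Ioc, ← intervalIntegral.integral_of_le hab,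
    intervalIntegral.integral_comp_sub_right
      (fun t => L (x + ∫ u in (0 : ℝ)..t, g u) (g t)) a, sub_self, hA]
  exact (integrableOn_congr_fun hae measurableSet_Icc).2
    ((intervalIntegrable_iff_integrableOn_Icc_of_le hab).1 hl')

theorem lower_bound_action {c₁ c₂ : ℝ} (hab : a ≤ b) (hc₁ : 0 < c₁)
    (hL3 : ∀ x v : Eu n, c₁ * ‖v‖ - c₂ ≤ L x v) :
    ((-(c₂ * (b - a)) : ℝ) : EReal) ≤ action L a b γ := by
  induction hA : action L a b γ with
  | bot => exact absurd hA action_ne_bot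
  | top => exact le_top
  | coe A => exact EReal.coe_le_coe_iff.2 ((reach_of_action_eq hab hA).lower_bound hc₁ hL3)

theorem minCost_le_action {c₁ c₂ : ℝ} (hab : a ≤ b) (hc₁ : 0 < c₁)
    (hL3 : ∀ x v : Eu n, c₁ * ‖v‖ - c₂ ≤ L x v) :
    (minCost L (b - a) (pev γ a) (pev γ b) : EReal) ≤ action L a b γ := by
  induction hA : action L a b γ with
  | bot => exact absurd hA action_ne_bot
  | top => exact le_top
  | coe A => exact EReal.coe_le_coe_iff.2 (minCost_le hc₁ hL3 (reach_of_action_eq hab hA))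

end Velocity

/-- Bounded sequences in a separable `L²` space have weakly convergent subsequences. -/
theorem exists_weak_limit_of_integral_sq_le {α E : Type*} [MeasurableSpace α] {μ : Measure α}
    [IsFiniteMeasure μ] [IsSeparable μ] [NormedAddCommGroup E] [InnerProductSpace ℝ E]
    [CompleteSpace E] [SecondCountableTopology E] {g : ℕ → α → E} {M : ℝ}
    (hg : ∀ k, MemLp (g k) 2 μ) (hM : ∀ k, ∫ t, ‖g k t‖ ^ 2 ∂μ ≤ M) :
    ∃ φ : ℕ → ℕ, StrictMono φ ∧ ∃ G : α → E, StronglyMeasurable G ∧ MemLp G 2 μ ∧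
      ∀ h : α → E, MemLp h 2 μ →
        Tendsto (fun k => ∫ t, inner ℝ (h t) (g (φ k) t) ∂μ) atTop
          (𝓝 (∫ t, inner ℝ (h t) (G t) ∂μ)) := by
  have : Fact ((2 : ℝ≥0∞) ≠ ∞) := ⟨by simp⟩
  have hinner : ∀ {u v : α → E} (hu : MemLp u 2 μ) (hv : MemLp v 2 μ),
      inner ℝ (hu.toLp u) (hv.toLp v) = ∫ t, inner ℝ (u t) (v t) ∂μ := by
    intro u v hu hv
    rw [L2.inner_def]
    refine integral_congr_ae ?_
    filter_upwards [hu.coeFn_toLp, hv.coeFn_toLp] with t h1 h2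
    rw [h1, h2]
  let D := InnerProductSpace.toDual ℝ (Lp E 2 μ)
  have hball : ∀ k, (WeakDual.toStrongDual.symm (D ((hg k).toLp (g k)))) ∈
      WeakDual.toStrongDual ⁻¹' Metric.closedBall (0 : StrongDual ℝ (Lp E 2 μ)) (√M) := by
    intro k
    rw [Set.mem_preimage, LinearEquiv.apply_symm_apply]
    refine (mem_closedBall_zero_iff (E := StrongDual ℝ (Lp E 2 μ))).2 ?_
    rw [LinearIsometryEquiv.norm_map]
    refine Real.le_sqrt_of_sq_le ?_
    rw [← real_inner_self_eq_norm_sq, hinner]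
    simpa only [real_inner_self_eq_norm_sq] using hM k
  obtain ⟨ℓ, -, φ, hφ, hlim⟩ := WeakDual.isSeqCompact_closedBall ℝ (Lp E 2 μ) 0 (√M) hball
  let G := D.symm (WeakDual.toStrongDual ℓ)
  refine ⟨φ, hφ, G, Lp.stronglyMeasurable G, Lp.memLp G, fun h hh => ?_⟩
  have h1 := ((WeakDual.eval_continuous (𝕜 := ℝ) (hh.toLp h)).tendsto ℓ).comp hlim
  have h2 : ℓ (hh.toLp h) = ∫ t, inner ℝ (h t) (G t) ∂μ := by
    rw [← hinner hh (Lp.memLp G), Lp.toLp_coeFn, real_inner_comm]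
    exact (InnerProductSpace.toDual_symm_apply (𝕜 := ℝ)).symm
  rw [h2] at h1
  refine h1.congr fun k => ?_
  rw [← hinner hh (hg _), real_inner_comm]
  rfl

section LowerSemicontinuity

variable {n : ℕ} {L : Eu n → Eu n → ℝ}

/-- A continuous function is uniformly close along uniformly close curves with bounded controls. -/
theorem eventually_dist_comp_lt {Y : Type*} [PseudoMetricSpace Y] {Φ : Eu n × Eu n → Y}
    (hΦ : Continuous Φ) {s : Set ℝ} (hs : IsCompact s) {γs : ℕ → ℝ → Eu n} {γ w : ℝ → Eu n}
    (hγ : ContinuousOn γ s) (hlim : TendstoUniformlyOn γs γ atTop s) {M : ℝ}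
    (hw : ∀ t, ‖w t‖ ≤ M) {ε : ℝ} (hε : 0 < ε) :
    ∀ᶠ k in atTop, ∀ t ∈ s, dist (Φ (γ t, w t)) (Φ (γs k t, w t)) < ε := by
  have hS : IsCompact ((γ '' s) ×ˢ Metric.closedBall (0 : Eu n) M) :=
    (hs.image_of_continuousOn hγ).prod (isCompact_closedBall _ _)
  have h := hS.uniformContinuousAt_of_continuousAt Φ (fun p _ => hΦ.continuousAt)
    (Metric.dist_mem_uniformity hε)
  obtain ⟨δ, hδ, hsub⟩ := Metric.mem_uniformity_dist.1 h
  filter_upwards [Metric.tendstoUniformlyOn_iff.1 hlim δ hδ] with k hk t ht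
  refine hsub (a := (γ t, w t)) (b := (γs k t, w t)) ?_
    (Set.mk_mem_prod (Set.mem_image_of_mem γ ht) (mem_closedBall_zero_iff.2 (hw t)))
  simpa [Prod.dist_eq, hδ] using hk t ht

/-- Lower semicontinuity of the action against a bounded control `w`. -/
theorem integral_tangent_le_of_weak_limit (hL1 : ContDiff ℝ (⊤ : ℕ∞) (Function.uncurry L))
    (hconv : ∀ x v w : Eu n, L x v + fderiv ℝ (L x) v w ≤ L x (v + w))
    {a b : ℝ} {γs g : ℕ → ℝ → Eu n} {γ G w : ℝ → Eu n}
    (hγ : ContinuousOn γ (Set.Icc a b))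
    (hlim : TendstoUniformlyOn γs γ atTop (Set.Icc a b))
    (hg : ∀ k, IntegrableOn (g k) (Set.Icc a b)) (hG : IntegrableOn G (Set.Icc a b))
    (hweak : ∀ h : ℝ → Eu n, MemLp h 2 (volume.restrict (Set.Icc a b)) →
      Tendsto (fun k => ∫ t in Set.Icc a b, inner ℝ (h t) (g k t)) atTop
        (𝓝 (∫ t in Set.Icc a b, inner ℝ (h t) (G t))))
    {ℓ A : ℝ} (hℓ : ∀ k, ∫ t in Set.Icc a b, ‖g k t‖ ≤ ℓ)
    (hl : ∀ k, IntegrableOn (fun t => L (γs k t) (g k t)) (Set.Icc a b))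
    (hA : ∀ k, ∫ t in Set.Icc a b, L (γs k t) (g k t) ≤ A)
    {M : ℝ} (hwm : StronglyMeasurable w) (hw : ∀ t, ‖w t‖ ≤ M) :
    IntegrableOn (fun t => L (γ t) (w t) + fderiv ℝ (L (γ t)) (w t) (G t - w t)) (Set.Icc a b) ∧
    ∫ t in Set.Icc a b, (L (γ t) (w t) + fderiv ℝ (L (γ t)) (w t) (G t - w t)) ≤ A := by
  set μ := volume.restrict (Set.Icc a b) with hμ
  set Λ : Eu n × Eu n → ℝ := Function.uncurry L with hΛ
  have hΛc : Continuous Λ := hL1.continuous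
  set Q : Eu n × Eu n → Eu n := fun p =>
    (InnerProductSpace.toDual ℝ (Eu n)).symm (fderiv ℝ (L p.1) p.2) with hQ
  have hQc : Continuous Q :=
    (InnerProductSpace.toDual ℝ (Eu n)).symm.continuous.comp (continuous_fderiv_velocity hL1)
  have hQi : ∀ p v, fderiv ℝ (L p.1) p.2 v = inner ℝ (Q p) v := fun p v =>
    (InnerProductSpace.toDual_symm_apply (𝕜 := ℝ)).symm
  have hpm : AEStronglyMeasurable (fun t => (γ t, w t)) μ :=
    (hγ.aestronglyMeasurable measurableSet_Icc).prodMk hwm.aestronglyMeasurable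
  have hS : IsCompact ((γ '' Set.Icc a b) ×ˢ Metric.closedBall (0 : Eu n) M) :=
    (isCompact_Icc.image_of_continuousOn hγ).prod (isCompact_closedBall _ _)
  have hmemS : ∀ t ∈ Set.Icc a b,
      (γ t, w t) ∈ (γ '' Set.Icc a b) ×ˢ Metric.closedBall (0 : Eu n) M := fun t ht =>
    Set.mk_mem_prod (Set.mem_image_of_mem γ ht) (mem_closedBall_zero_iff.2 (hw t))
  obtain ⟨C₁, hC₁⟩ := hS.exists_bound_of_continuousOn hΛc.continuousOn
  obtain ⟨C₂, hC₂⟩ := hS.exists_bound_of_continuousOn hQc.continuousOn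
  have hwL : MemLp w ∞ μ := memLp_top_of_bound hwm.aestronglyMeasurable M (ae_of_all _ hw)
  have hwI : Integrable w μ := hwL.integrable le_top
  have hLI : Integrable (fun t => Λ (γ t, w t)) μ :=
    Integrable.of_bound (hΛc.comp_aestronglyMeasurable hpm) C₁
      ((ae_restrict_iff' measurableSet_Icc).2 (ae_of_all _ fun t ht => hC₁ _ (hmemS t ht)))
  have hQL : MemLp (fun t => Q (γ t, w t)) ∞ μ :=
    memLp_top_of_bound (hQc.comp_aestronglyMeasurable hpm) C₂
      ((ae_restrict_iff' measurableSet_Icc).2 (ae_of_all _ fun t ht => hC₂ _ (hmemS t ht)))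
  have hQI : ∀ {u : ℝ → Eu n}, Integrable u μ →
      Integrable (fun t => inner ℝ (Q (γ t, w t)) (u t)) μ := by
    intro u hu
    have hm : AEStronglyMeasurable (fun t => inner ℝ (Q (γ t, w t)) (u t)) μ :=
      hQL.aestronglyMeasurable.inner hu.aestronglyMeasurable
    refine (hu.norm.const_mul C₂).mono' hm
      ((ae_restrict_iff' measurableSet_Icc).2 (ae_of_all _ fun t ht => ?_))
    exact (norm_inner_le_norm _ _).trans
      (mul_le_mul_of_nonneg_right (hC₂ _ (hmemS t ht)) (norm_nonneg _))
  have hrew : ∀ t, L (γ t) (w t) + fderiv ℝ (L (γ t)) (w t) (G t - w t) =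
      Λ (γ t, w t) + (inner ℝ (Q (γ t, w t)) (G t) - inner ℝ (Q (γ t, w t)) (w t)) := by
    intro t
    rw [← inner_sub_right, ← hQi]
    rfl
  simp only [hrew]
  have hsub : ∀ {u : ℝ → Eu n}, Integrable u μ → Integrable (fun t =>
      inner ℝ (Q (γ t, w t)) (u t) - inner ℝ (Q (γ t, w t)) (w t)) μ := fun hu =>
    (hQI hu).sub (hQI hwI)
  have hsplit : ∀ {u : ℝ → Eu n}, Integrable u μ → ∫ t, (Λ (γ t, w t) +
      (inner ℝ (Q (γ t, w t)) (u t) - inner ℝ (Q (γ t, w t)) (w t))) ∂μ =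
      (∫ t, Λ (γ t, w t) ∂μ) + ((∫ t, inner ℝ (Q (γ t, w t)) (u t) ∂μ) -
        ∫ t, inner ℝ (Q (γ t, w t)) (w t) ∂μ) := fun hu => by
    rw [integral_add hLI (hsub hu), integral_sub (hQI hu) (hQI hwI)]
  refine ⟨hLI.add (hsub hG), ?_⟩
  rw [hsplit hG]
  have hlimk : Tendsto (fun k => (∫ t, Λ (γ t, w t) ∂μ) +
      ((∫ t, inner ℝ (Q (γ t, w t)) (g k t) ∂μ) - ∫ t, inner ℝ (Q (γ t, w t)) (w t) ∂μ)) atTop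
      (𝓝 ((∫ t, Λ (γ t, w t) ∂μ) +
      ((∫ t, inner ℝ (Q (γ t, w t)) (G t) ∂μ) - ∫ t, inner ℝ (Q (γ t, w t)) (w t) ∂μ))) :=
    tendsto_const_nhds.add ((hweak _ (hQL.mono_exponent le_top)).sub tendsto_const_nhds)
  have hfin : ∀ ε > 0, (∫ t, Λ (γ t, w t) ∂μ) +
      ((∫ t, inner ℝ (Q (γ t, w t)) (G t) ∂μ) - ∫ t, inner ℝ (Q (γ t, w t)) (w t) ∂μ) ≤
      A + ε * (μ.real Set.univ + (ℓ + M * μ.real Set.univ)) := by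
    intro ε hε
    refine le_of_tendsto hlimk ?_
    filter_upwards [eventually_dist_comp_lt hΛc isCompact_Icc hγ hlim hw hε,
      eventually_dist_comp_lt hQc isCompact_Icc hγ hlim hw hε] with k hk1 hk2
    have hgk : Integrable (g k) μ := hg k
    have hgM : Integrable (fun t => ‖g k t‖ + M) μ := hgk.norm.add (integrable_const _)
    have hE : Integrable (fun t => ε * (1 + (‖g k t‖ + M))) μ :=
      ((integrable_const (1 : ℝ)).add hgM).const_mul ε
    have hpt : ∀ t ∈ Set.Icc a b, Λ (γ t, w t) +
        (inner ℝ (Q (γ t, w t)) (g k t) - inner ℝ (Q (γ t, w t)) (w t)) ≤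
        L (γs k t) (g k t) + ε * (1 + (‖g k t‖ + M)) := by
      intro t ht
      have h1 := hconv (γs k t) (w t) (g k t - w t)
      rw [add_sub_cancel, hQi (γs k t, w t)] at h1
      have h2 := (le_abs_self _).trans (hk1 t ht).le
      have h3 : inner ℝ (Q (γ t, w t) - Q (γs k t, w t)) (g k t - w t) ≤ ε * (‖g k t‖ + M) := by
        refine (real_inner_le_norm _ _).trans (mul_le_mul ?_ ?_ (norm_nonneg _) hε.le)
        · rw [← dist_eq_norm]; exact (hk2 t ht).le
        · exact (norm_sub_le _ _).trans (add_le_add le_rfl (hw t))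
      rw [inner_sub_left] at h3
      rw [← inner_sub_right]
      have h4 : Λ (γs k t, w t) = L (γs k t) (w t) := rfl
      linarith
    have hlk : Integrable (fun t => L (γs k t) (g k t)) μ := hl k
    calc (∫ t, Λ (γ t, w t) ∂μ) +
        ((∫ t, inner ℝ (Q (γ t, w t)) (g k t) ∂μ) - ∫ t, inner ℝ (Q (γ t, w t)) (w t) ∂μ)
        = ∫ t, (Λ (γ t, w t) +
          (inner ℝ (Q (γ t, w t)) (g k t) - inner ℝ (Q (γ t, w t)) (w t))) ∂μ := (hsplit hgk).symm
      _ ≤ ∫ t, (L (γs k t) (g k t) + ε * (1 + (‖g k t‖ + M))) ∂μ :=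
          setIntegral_mono_on (hLI.add (hsub hgk)) (hlk.add hE)
            measurableSet_Icc hpt
      _ = (∫ t, L (γs k t) (g k t) ∂μ) +
          ε * (μ.real Set.univ + ((∫ t, ‖g k t‖ ∂μ) + M * μ.real Set.univ)) := by
          rw [integral_add hlk hE, integral_const_mul,
            integral_add (integrable_const _) hgM,
            integral_add hgk.norm (integrable_const _)]
          simp [mul_comm]
      _ ≤ _ := by
          gcongr
          · exact hA k
          · exact hℓ k
  have hεlim : Tendsto (fun ε : ℝ => A + ε * (μ.real Set.univ + (ℓ + M * μ.real Set.univ)))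
      (𝓝[>] 0) (𝓝 A) := by
    have : Tendsto (fun ε : ℝ => A + ε * (μ.real Set.univ + (ℓ + M * μ.real Set.univ)))
        (𝓝 0) (𝓝 (A + 0 * (μ.real Set.univ + (ℓ + M * μ.real Set.univ)))) :=
      (Continuous.tendsto (by fun_prop) 0)
    rw [zero_mul, add_zero] at this
    exact this.mono_left nhdsWithin_le_nhds
  exact ge_of_tendsto hεlim (eventually_nhdsWithin_of_forall fun ε hε => hfin ε hε)

/-- Weak lower semicontinuity of the action under uniform convergence of the curves and weak
convergence of the velocities. -/
theorem integral_lagrangian_le_of_weak_limit (hL1 : ContDiff ℝ (⊤ : ℕ∞) (Function.uncurry L))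
    (hconv : ∀ x v w : Eu n, L x v + fderiv ℝ (L x) v w ≤ L x (v + w))
    {a b : ℝ} {γs g : ℕ → ℝ → Eu n} {γ G : ℝ → Eu n} (hγ : ContinuousOn γ (Set.Icc a b))
    (hlim : TendstoUniformlyOn γs γ atTop (Set.Icc a b))
    (hg : ∀ k, IntegrableOn (g k) (Set.Icc a b)) (hG : IntegrableOn G (Set.Icc a b))
    (hGm : StronglyMeasurable G)
    (hweak : ∀ h : ℝ → Eu n, MemLp h 2 (volume.restrict (Set.Icc a b)) →
      Tendsto (fun k => ∫ t in Set.Icc a b, inner ℝ (h t) (g k t)) atTop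
        (𝓝 (∫ t in Set.Icc a b, inner ℝ (h t) (G t))))
    {ℓ A : ℝ} (hℓ : ∀ k, ∫ t in Set.Icc a b, ‖g k t‖ ≤ ℓ)
    (hl : ∀ k, IntegrableOn (fun t => L (γs k t) (g k t)) (Set.Icc a b))
    (hA : ∀ k, ∫ t in Set.Icc a b, L (γs k t) (g k t) ≤ A) :
    IntegrableOn (fun t => L (γ t) (G t)) (Set.Icc a b) ∧
      ∫ t in Set.Icc a b, L (γ t) (G t) ≤ A := by
  set μ := volume.restrict (Set.Icc a b)
  set F : (ℝ → Eu n) → ℝ → ℝ := fun w t =>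
    L (γ t) (w t) + fderiv ℝ (L (γ t)) (w t) (G t - w t) with hF
  have key : ∀ (w : ℝ → Eu n) (M : ℝ), StronglyMeasurable w → (∀ t, ‖w t‖ ≤ M) →
      Integrable (F w) μ ∧ ∫ t, F w t ∂μ ≤ A := fun w M h1 h2 =>
    integral_tangent_le_of_weak_limit hL1 hconv hγ hlim hg hG hweak hℓ hl hA h1 h2
  set H : ℝ → ℝ := F 0
  have hH : Integrable H μ := (key 0 0 stronglyMeasurable_zero (by simp)).1
  set w : ℕ → ℝ → Eu n := fun m => {t | ‖G t‖ ≤ m}.indicator G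
  have hwin : ∀ (m : ℕ) t, ‖G t‖ ≤ m → w m t = G t := fun m t ht =>
    Set.indicator_of_mem (s := {t | ‖G t‖ ≤ m}) ht _
  have hwout : ∀ (m : ℕ) t, ¬ ‖G t‖ ≤ m → w m t = 0 := fun m t ht =>
    Set.indicator_of_notMem (s := {t | ‖G t‖ ≤ m}) ht _
  have hw : ∀ m, Integrable (F (w m)) μ ∧ ∫ t, F (w m) t ∂μ ≤ A := by
    refine fun m => key _ m (hGm.indicator (hGm.norm.measurable measurableSet_Iic)) fun t => ?_
    by_cases ht : ‖G t‖ ≤ m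
    · rw [hwin m t ht]; exact ht
    · rw [hwout m t ht, norm_zero]; positivity
  have hFin : ∀ (m : ℕ) t, ‖G t‖ ≤ m → F (w m) t = L (γ t) (G t) := by
    intro m t ht
    simp [hF, hwin m t ht]
  have hFout : ∀ (m : ℕ) t, ¬ ‖G t‖ ≤ m → F (w m) t = H t := by
    intro m t ht
    simp [hF, H, hwout m t ht]
  have hHL : ∀ t, H t ≤ L (γ t) (G t) := by
    intro t
    simpa [hF, H] using hconv (γ t) 0 (G t)
  have hmono : ∀ t, Monotone fun m => ENNReal.ofReal (F (w m) t - H t) := by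
    intro t m m' hmm
    refine ENNReal.ofReal_le_ofReal (sub_le_sub_right ?_ _)
    by_cases ht : ‖G t‖ ≤ m
    · rw [hFin m t ht, hFin m' t (ht.trans (by exact_mod_cast hmm))]
    · rw [hFout m t ht]
      by_cases ht' : ‖G t‖ ≤ m'
      · rw [hFin m' t ht']; exact hHL t
      · rw [hFout m' t ht']
  have htend : ∀ t, Tendsto (fun m => ENNReal.ofReal (F (w m) t - H t)) atTop
      (𝓝 (ENNReal.ofReal (L (γ t) (G t) - H t))) := by
    intro t
    obtain ⟨m₀, hm₀⟩ := exists_nat_ge ‖G t‖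
    refine tendsto_const_nhds.congr' ?_
    filter_upwards [eventually_ge_atTop m₀] with m hm
    rw [hFin m t (hm₀.trans (by exact_mod_cast hm))]
  have hnn : ∀ m t, 0 ≤ F (w m) t - H t := by
    intro m t
    by_cases ht : ‖G t‖ ≤ m
    · rw [hFin m t ht]; exact sub_nonneg.2 (hHL t)
    · rw [hFout m t ht, sub_self]
  have hwH : ∀ m, Integrable (fun t => F (w m) t - H t) μ := fun m => (hw m).1.sub hH
  have hle : ∫⁻ t, ENNReal.ofReal (L (γ t) (G t) - H t) ∂μ ≤
      ENNReal.ofReal (A - ∫ t, H t ∂μ) := by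
    refine le_of_tendsto' (lintegral_tendsto_of_tendsto_of_monotone
      (fun m => (hwH m).aestronglyMeasurable.aemeasurable.ennreal_ofReal)
      (ae_of_all _ hmono) (ae_of_all _ htend)) fun m => ?_
    rw [← ofReal_integral_eq_lintegral_ofReal (hwH m) (ae_of_all _ (hnn m)),
      integral_sub (hw m).1 hH]
    exact ENNReal.ofReal_le_ofReal (sub_le_sub_right (hw m).2 _)
  have hA0 : 0 ≤ A - ∫ t, H t ∂μ := by
    have := (key 0 0 stronglyMeasurable_zero (by simp)).2
    exact sub_nonneg.2 this
  have hmeas : AEStronglyMeasurable (fun t => L (γ t) (G t)) μ :=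
    hL1.continuous.comp_aestronglyMeasurable
      ((hγ.aestronglyMeasurable measurableSet_Icc).prodMk hGm.aestronglyMeasurable)
  have hDI : Integrable (fun t => L (γ t) (G t) - H t) μ := by
    refine ⟨hmeas.sub hH.aestronglyMeasurable, ?_⟩
    rw [hasFiniteIntegral_iff_ofReal (ae_of_all _ fun t => sub_nonneg.2 (hHL t))]
    exact hle.trans_lt ENNReal.ofReal_lt_top
  have hI : Integrable (fun t => L (γ t) (G t)) μ :=
    (hDI.add hH).congr (ae_of_all _ fun t => sub_add_cancel (L (γ t) (G t)) (H t))
  refine ⟨hI, ?_⟩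
  have h1 : ∫ t, (L (γ t) (G t) - H t) ∂μ ≤ A - ∫ t, H t ∂μ := by
    rw [integral_eq_lintegral_of_nonneg_ae (ae_of_all _ fun t => sub_nonneg.2 (hHL t))
      hDI.aestronglyMeasurable]
    exact ENNReal.toReal_le_of_le_ofReal hA0 hle
  rw [integral_sub hI hH] at h1
  linarith

end LowerSemicontinuity

section Compactness

variable {n : ℕ} {L : Eu n → Eu n → ℝ} {a b : ℝ}

theorem exists_quadratic_lower_bound (hL1 : ContDiff ℝ (⊤ : ℕ∞) (Function.uncurry L))
    (hL2 : ∀ K : Set (Eu n), IsCompact K → ∃ c₀ : ℝ, 0 < c₀ ∧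
      ∀ x ∈ K, ∀ v w : Eu n, c₀ * ‖w‖ ^ 2 ≤ fderiv ℝ (fderiv ℝ (L x)) v w w)
    {K : Set (Eu n)} (hK : IsCompact K) :
    ∃ c > 0, ∃ C, ∀ x ∈ K, ∀ v, c * ‖v‖ ^ 2 ≤ L x v + C := by
  obtain ⟨c₀, hc₀, hc⟩ := hL2 K hK
  have h0 : Continuous fun x : Eu n => L x 0 :=
    hL1.continuous.comp (f := fun x : Eu n => (x, (0 : Eu n))) (by fun_prop)
  have h1 : Continuous fun x : Eu n => fderiv ℝ (L x) 0 :=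
    (continuous_fderiv_velocity hL1).comp (f := fun x : Eu n => (x, (0 : Eu n))) (by fun_prop)
  obtain ⟨C₁, hC₁⟩ := hK.exists_bound_of_continuousOn h0.continuousOn
  obtain ⟨C₂, hC₂⟩ := hK.exists_bound_of_continuousOn h1.continuousOn
  refine ⟨c₀ / 4, by positivity, C₁ + C₂ ^ 2 / c₀, fun x hx v => ?_⟩
  have ht := taylor_lower_bound hL1 (hc x hx) 0 v
  rw [zero_add] at ht
  have h2 := (abs_le.1 (hC₁ x hx)).1
  have h3 : -(C₂ * ‖v‖) ≤ fderiv ℝ (L x) 0 v := by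
    refine (abs_le.1 (((fderiv ℝ (L x) 0).le_opNorm v).trans ?_)).1
    exact mul_le_mul_of_nonneg_right (hC₂ x hx) (norm_nonneg _)
  have h4 : C₂ * ‖v‖ ≤ C₂ ^ 2 / c₀ + c₀ / 4 * ‖v‖ ^ 2 := by
    have : C₂ ^ 2 / c₀ + c₀ / 4 * ‖v‖ ^ 2 - C₂ * ‖v‖ = (C₂ - c₀ / 2 * ‖v‖) ^ 2 / c₀ := by
      field_simp
      ring
    have h5 : 0 ≤ (C₂ - c₀ / 2 * ‖v‖) ^ 2 / c₀ := by positivity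
    linarith
  linarith

theorem convex_tangent_bound (hL1 : ContDiff ℝ (⊤ : ℕ∞) (Function.uncurry L))
    (hL2 : ∀ K : Set (Eu n), IsCompact K → ∃ c₀ : ℝ, 0 < c₀ ∧
      ∀ x ∈ K, ∀ v w : Eu n, c₀ * ‖w‖ ^ 2 ≤ fderiv ℝ (fderiv ℝ (L x)) v w w) (x v w : Eu n) :
    L x v + fderiv ℝ (L x) v w ≤ L x (v + w) := by
  obtain ⟨c₀, hc₀, hc⟩ := hL2 {x} isCompact_singleton
  have := taylor_lower_bound hL1 (hc x rfl) v w
  have : 0 ≤ c₀ / 2 * ‖w‖ ^ 2 := by positivity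
  linarith

/-- The modulus of continuity of a curve whose velocity is bounded in `L²`. -/
theorem IsVelocity.dist_le {γ : CPath a b n} {g : ℝ → Eu n} (hg : IsVelocity γ g)
    (h2 : IntegrableOn (fun t => ‖g t‖ ^ 2) (Set.Icc a b)) {E : ℝ}
    (hE : ∫ t in Set.Icc a b, ‖g t‖ ^ 2 ≤ E) (s t : Set.Icc a b) :
    dist (γ s) (γ t) ≤ √(dist s t) * (E + 1) := by
  wlog hst : s ≤ t generalizing s t
  · rw [dist_comm, dist_comm s]
    exact this t s (le_of_not_ge hst)
  rcases hst.eq_or_lt with rfl | hlt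
  · simp
  have hst' : (s : ℝ) < t := hlt
  have hd : dist s t = (t : ℝ) - s := by
    rw [Subtype.dist_eq, dist_comm, Real.dist_eq, abs_of_pos (sub_pos.2 hst')]
  set d := (t : ℝ) - s with hd'
  have hd0 : 0 < d := sub_pos.2 hst'
  have hsq : 0 < √d := Real.sqrt_pos.2 hd0
  have hsub : Set.Icc (s : ℝ) t ⊆ Set.Icc a b := Set.Icc_subset_Icc s.2.1 t.2.2
  have hsub' : Set.Ioc (s : ℝ) t ⊆ Set.Icc a b := Set.Ioc_subset_Icc_self.trans hsub
  rw [hd, dist_comm, dist_eq_norm, hg.2 s t, add_sub_cancel_left]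
  have hpt : ∀ x : ℝ, x ≤ √d * x ^ 2 + 1 / √d := by
    intro x
    have : √d * x ^ 2 + 1 / √d - x = ((√d * x - 1 / 2) ^ 2 + 3 / 4) / √d := by
      field_simp
      ring
    have h5 : 0 ≤ ((√d * x - 1 / 2) ^ 2 + 3 / 4) / √d := by positivity
    linarith
  calc ‖∫ u in (s : ℝ)..t, g u‖ ≤ ∫ u in (s : ℝ)..t, ‖g u‖ :=
        intervalIntegral.norm_integral_le_integral_norm hst'.le
    _ = ∫ u in Set.Ioc (s : ℝ) t, ‖g u‖ := intervalIntegral.integral_of_le hst'.le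
    _ ≤ ∫ u in Set.Ioc (s : ℝ) t, (√d * ‖g u‖ ^ 2 + 1 / √d) :=
        integral_mono (hg.1.mono_set hsub').norm
          (((h2.mono_set hsub').const_mul _).add (integrable_const _)) fun u => hpt _
    _ = √d * (∫ u in Set.Ioc (s : ℝ) t, ‖g u‖ ^ 2) + d * (1 / √d) := by
        rw [integral_add ((h2.mono_set hsub').const_mul _) (integrable_const _),
          integral_const_mul]
        simp [hd', hst'.le]
    _ ≤ √d * E + √d := by
        gcongr
        · exact (setIntegral_mono_set h2 (ae_of_all _ fun _ => by positivity)
            hsub'.eventuallyLE).trans hE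
        · rw [mul_one_div, Real.div_sqrt]
    _ = √d * (E + 1) := by ring

theorem tendsto_integral_of_weak {μ : Measure ℝ} [IsFiniteMeasure μ] {g : ℕ → ℝ → Eu n}
    {G : ℝ → Eu n} (hg : ∀ k, Integrable (g k) μ) (hG : Integrable G μ)
    (h : ∀ h : ℝ → Eu n, MemLp h 2 μ → Tendsto (fun k => ∫ t, inner ℝ (h t) (g k t) ∂μ) atTop
        (𝓝 (∫ t, inner ℝ (h t) (G t) ∂μ))) {s : Set ℝ} (hs : MeasurableSet s) :
    Tendsto (fun k => ∫ t in s, g k t ∂μ) atTop (𝓝 (∫ t in s, G t ∂μ)) := by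
  have hcoord : ∀ e : Eu n, Tendsto (fun k => inner ℝ e (∫ t in s, g k t ∂μ)) atTop
      (𝓝 (inner ℝ e (∫ t in s, G t ∂μ))) := by
    intro e
    have hconv : ∀ {u : ℝ → Eu n}, Integrable u μ →
        ∫ t, inner ℝ (s.indicator (fun _ => e) t) (u t) ∂μ = inner ℝ e (∫ t in s, u t ∂μ) := by
      intro u hu
      rw [← integral_inner hu.integrableOn, ← integral_indicator hs]
      refine integral_congr_ae (ae_of_all _ fun t => ?_)
      by_cases ht : t ∈ s <;> simp [ht]
    have := h (s.indicator fun _ => e) (memLp_indicator_const 2 hs e (Or.inr (by finiteness)))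
    rw [hconv hG] at this
    exact this.congr fun k => hconv (hg k)
  rw [(PiLp.homeomorph 2 (fun _ : Fin n => ℝ)).isInducing.tendsto_nhds_iff, tendsto_pi_nhds]
  intro i
  have := hcoord (EuclideanSpace.single i 1)
  simp only [EuclideanSpace.inner_single_left, map_one, one_mul] at this
  exact this

/-- Curves of bounded action starting in a compact set are sequentially precompact, and the action
is sequentially lower semicontinuous along them. -/
theorem exists_subseq_tendsto_action_le (hab : a ≤ b)
    (hL1 : ContDiff ℝ (⊤ : ℕ∞) (Function.uncurry L))
    (hL2 : ∀ K : Set (Eu n), IsCompact K → ∃ c₀ : ℝ, 0 < c₀ ∧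
      ∀ x ∈ K, ∀ v w : Eu n, c₀ * ‖w‖ ^ 2 ≤ fderiv ℝ (fderiv ℝ (L x)) v w w)
    {c₁ c₂ : ℝ} (hc₁ : 0 < c₁) (hL3 : ∀ x v : Eu n, c₁ * ‖v‖ - c₂ ≤ L x v)
    {K : Set (Eu n)} (hK : IsCompact K) {A : ℝ} {γs : ℕ → CPath a b n}
    (hstart : ∀ k, pev (γs k) a ∈ K) (hA : ∀ k, action L a b (γs k) ≤ A) :
    ∃ φ : ℕ → ℕ, StrictMono φ ∧ ∃ γ : CPath a b n,
      Tendsto (γs ∘ φ) atTop (𝓝 γ) ∧ action L a b γ ≤ A := by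
  set μ := volume.restrict (Set.Icc a b) with hμ
  have hμu : μ.real Set.univ = b - a := by simp [hμ, hab]
  choose g hg hl hact using fun k =>
    exists_velocity_of_action_ne_top (((hA k).trans_lt (EReal.coe_lt_top A)).ne)
  have hint : ∀ k, ∫ t, L (pev (γs k) t) (g k t) ∂μ ≤ A := fun k =>
    EReal.coe_le_coe_iff.1 ((hact k).symm.trans_le (hA k))
  have hgI : ∀ k, Integrable (g k) μ := fun k => (hg k).1
  have hlI : ∀ k, Integrable (fun t => L (pev (γs k) t) (g k t)) μ := hl
  -- the length bound
  set ℓ := (A + c₂ * (b - a)) / c₁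
  have hℓ : ∀ k, ∫ t, ‖g k t‖ ∂μ ≤ ℓ := by
    intro k
    rw [le_div_iff₀ hc₁, mul_comm, ← integral_const_mul]
    calc ∫ t, c₁ * ‖g k t‖ ∂μ ≤ ∫ t, (L (pev (γs k) t) (g k t) + c₂) ∂μ :=
          integral_mono ((hgI k).norm.const_mul _) ((hlI k).add (integrable_const _))
            fun t => by linarith [hL3 (pev (γs k) t) (g k t)]
      _ = (∫ t, L (pev (γs k) t) (g k t) ∂μ) + c₂ * (b - a) := by
          rw [integral_add (hlI k) (integrable_const _), integral_const, hμu, smul_eq_mul, mul_comm]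
      _ ≤ _ := by linarith [hint k]
  obtain ⟨R, hR⟩ := hK.isBounded.exists_norm_le
  have hball : ∀ k, ∀ t ∈ Set.Icc a b,
      pev (γs k) t ∈ Metric.closedBall (0 : Eu n) (R + ℓ) := by
    intro k t ht
    rw [mem_closedBall_zero_iff, (hg k).pev_eq hab ht]
    refine (norm_add_le _ _).trans (add_le_add (hR _ (hstart k)) ?_)
    refine (intervalIntegral.norm_integral_le_integral_norm ht.1).trans (le_trans ?_ (hℓ k))
    rw [intervalIntegral.integral_of_le ht.1]
    exact setIntegral_mono_set (hgI k).norm (ae_of_all _ fun _ => norm_nonneg _)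
      (Set.Ioc_subset_Icc_self.trans (Set.Icc_subset_Icc_right ht.2)).eventuallyLE
  -- the `L²` bound
  obtain ⟨c, hc, C, hquad⟩ :=
    exists_quadratic_lower_bound hL1 hL2 (isCompact_closedBall (0 : Eu n) (R + ℓ))
  have hsqI : ∀ k, Integrable (fun t => ‖g k t‖ ^ 2) μ := by
    intro k
    refine (((hlI k).add (integrable_const C)).const_mul c⁻¹).mono'
      ((hgI k).aestronglyMeasurable.norm.pow 2)
      ((ae_restrict_iff' measurableSet_Icc).2 (ae_of_all _ fun t ht => ?_))
    rw [Real.norm_of_nonneg (by positivity), le_inv_mul_iff₀ hc]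
    exact hquad _ (hball k t ht) _
  set E := (A + C * (b - a)) / c
  have hE : ∀ k, ∫ t, ‖g k t‖ ^ 2 ∂μ ≤ E := by
    intro k
    rw [le_div_iff₀ hc, mul_comm, ← integral_const_mul]
    calc ∫ t, c * ‖g k t‖ ^ 2 ∂μ ≤ ∫ t, (L (pev (γs k) t) (g k t) + C) ∂μ :=
          setIntegral_mono_on ((hsqI k).const_mul _) ((hlI k).add (integrable_const _))
            measurableSet_Icc fun t ht => hquad _ (hball k t ht) _
      _ = (∫ t, L (pev (γs k) t) (g k t) ∂μ) + C * (b - a) := by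
          rw [integral_add (hlI k) (integrable_const _), integral_const, hμu, smul_eq_mul, mul_comm]
      _ ≤ _ := by linarith [hint k]
  obtain ⟨φ₁, hφ₁, G, hGm, hG2, hweak⟩ := exists_weak_limit_of_integral_sq_le
    (fun k => (memLp_two_iff_integrable_sq_norm (hgI k).aestronglyMeasurable).2 (hsqI k)) hE
  obtain ⟨x, -, φ₂, hφ₂, hx⟩ := hK.tendsto_subseq (x := fun k => pev (γs (φ₁ k)) a)
    fun k => hstart _
  set φ := φ₁ ∘ φ₂
  have hweak' : ∀ h : ℝ → Eu n, MemLp h 2 μ →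
      Tendsto (fun k => ∫ t, inner ℝ (h t) (g (φ k) t) ∂μ) atTop
        (𝓝 (∫ t, inner ℝ (h t) (G t) ∂μ)) := fun h hh => (hweak h hh).comp hφ₂.tendsto_atTop
  have hGI : Integrable G μ := hG2.integrable one_le_two
  have hGi : IntervalIntegrable G volume a b :=
    (intervalIntegrable_iff_integrableOn_Icc_of_le hab).2 hGI
  -- the limit curve
  have hcont : ContinuousOn (fun t => x + ∫ u in a..t, G u) (Set.Icc a b) := by
    have h1 := intervalIntegral.continuousOn_primitive_interval' hGi Set.left_mem_uIcc
    rw [Set.uIcc_of_le hab] at h1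
    exact continuousOn_const.add h1
  let γ : CPath a b n := ⟨_, continuousOn_iff_continuous_domRestrict.1 hcont⟩
  have hγ : ∀ t ∈ Set.Icc a b, pev γ t = x + ∫ u in a..t, G u := fun t ht => pev_of_mem ht
  have hvel : IsVelocity γ G := by
    refine isVelocity_of_pev_eq hab hGI fun t ht => ?_
    rw [hγ t ht, hγ a (Set.left_mem_Icc.2 hab), intervalIntegral.integral_same, add_zero]
  have hpt : ∀ t : Set.Icc a b, Tendsto (fun k => γs (φ k) t) atTop (𝓝 (γ t)) := by
    intro t
    have hin : Set.Icc a b ∩ Set.Ioc a (t : ℝ) = Set.Ioc a (t : ℝ) :=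
      Set.inter_eq_right.2 (Set.Ioc_subset_Icc_self.trans (Set.Icc_subset_Icc_right t.2.2))
    have h1 := tendsto_integral_of_weak (fun k => hgI (φ k)) hGI hweak'
      (measurableSet_Ioc (a := a) (b := (t : ℝ)))
    have hres : μ.restrict (Set.Ioc a (t : ℝ)) = volume.restrict (Set.Ioc a (t : ℝ)) := by
      rw [hμ, Measure.restrict_restrict measurableSet_Ioc, Set.inter_comm, hin]
    rw [hres] at h1
    have h2 := hx.add h1
    rw [← intervalIntegral.integral_of_le t.2.1, ← hγ t t.2, pev_of_mem t.2] at h2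
    refine h2.congr fun k => ?_
    rw [← intervalIntegral.integral_of_le t.2.1]
    exact ((hg (φ k)).pev_eq hab t.2).symm.trans (pev_of_mem t.2)
  have hequi : Equicontinuous fun k => (γs (φ k) : Set.Icc a b → Eu n) := by
    refine Metric.equicontinuous_of_continuity_modulus (fun d => √d * (E + 1)) ?_ _ fun s t k =>
      (hg (φ k)).dist_le (hsqI _) (hE _) s t
    have : Continuous fun d : ℝ => √d * (E + 1) := by fun_prop
    simpa using this.tendsto 0
  have hunif : TendstoUniformly (fun k => (γs (φ k) : Set.Icc a b → Eu n)) γ atTop :=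
    UniformFun.tendsto_iff_tendstoUniformly.1
      ((hequi.tendsto_uniformFun_iff_pi atTop γ).2 (tendsto_pi_nhds.2 hpt))
  have hunif' : TendstoUniformlyOn (fun k => pev (γs (φ k))) (pev γ) atTop (Set.Icc a b) := by
    rw [Metric.tendstoUniformlyOn_iff]
    intro ε hε
    filter_upwards [Metric.tendstoUniformly_iff.1 hunif ε hε] with k hk t ht
    rw [pev_of_mem ht, pev_of_mem ht]
    exact hk ⟨t, ht⟩
  have hpev : ContinuousOn (pev γ) (Set.Icc a b) := hcont.congr hγ
  obtain ⟨hI, hle⟩ := integral_lagrangian_le_of_weak_limit hL1 (convex_tangent_bound hL1 hL2)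
    hpev hunif' (fun k => hgI (φ k)) hGI hGm hweak' (fun k => hℓ (φ k)) (fun k => hl (φ k))
    fun k => hint (φ k)
  refine ⟨φ, hφ₁.comp hφ₂, γ, ContinuousMap.tendsto_iff_tendstoUniformly.2 hunif, ?_⟩
  rw [action_eq hab hvel hI]
  exact EReal.coe_le_coe_iff.2 hle

end Compactness

/-- Weak convergence of probability measures in the sense of `WeakLim` is convergence in
`ProbabilityMeasure`. -/
theorem weakLim_iff_tendsto {X : Type*} [TopologicalSpace X] [MeasurableSpace X]
    [OpensMeasurableSpace X] {πs : ℕ → ProbabilityMeasure X} {π : ProbabilityMeasure X} :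
    WeakLim (fun k => (πs k : Measure X)) (π : Measure X) ↔ Tendsto πs atTop (𝓝 π) :=
  ProbabilityMeasure.tendsto_iff_forall_integral_tendsto.symm

/-- Lower semicontinuity of `π ↦ ∫⁻ G dπ` under weak convergence, for lower semicontinuous
`G ≥ 0`. -/
theorem lintegral_le_liminf_lintegral_of_lowerSemicontinuous {X : Type*} [TopologicalSpace X]
    [MeasurableSpace X] [OpensMeasurableSpace X] [HasOuterApproxClosed X]
    {πs : ℕ → ProbabilityMeasure X}
    {π : ProbabilityMeasure X} (h : Tendsto πs atTop (𝓝 π)) {G : X → ℝ≥0∞}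
    (hG : LowerSemicontinuous G) :
    ∫⁻ x, G x ∂(π : Measure X) ≤ liminf (fun k => ∫⁻ x, G x ∂(πs k : Measure X)) atTop := by
  have hmeas : Measurable G := hG.measurable
  have hcap : ∀ M : ℕ, ∫⁻ x, min (G x) M ∂(π : Measure X) ≤
      liminf (fun k => ∫⁻ x, G x ∂(πs k : Measure X)) atTop := by
    intro M
    set f : X → ℝ := fun x => (min (G x) M).toReal with hf
    have hfin : ∀ x, min (G x) (M : ℝ≥0∞) ≠ ⊤ := fun x =>
      ne_top_of_le_ne_top (ENNReal.natCast_ne_top M) (min_le_right _ _)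
    have hf0 : ∀ x, 0 ≤ f x := fun x => ENNReal.toReal_nonneg
    have hfm : Measurable f := (hmeas.min measurable_const).ennreal_toReal
    have hopen : ∀ t : ℝ, 0 < t → IsOpen {x | t < f x} := by
      intro t ht
      have : {x | t < f x} = {x | ENNReal.ofReal t < G x} ∩ {_x | ENNReal.ofReal t < (M : ℝ≥0∞)} := by
        ext x
        simp only [Set.mem_ofPred_eq, Set.mem_inter_iff, hf]
        rw [← lt_min_iff, ENNReal.ofReal_lt_iff_lt_toReal ht.le (hfin x)]
      rw [this]
      exact (hG.isOpen_preimage _).inter isOpen_const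
    have hfG : ∀ x, min (G x) (M : ℝ≥0∞) = ENNReal.ofReal (f x) := fun x =>
      (ENNReal.ofReal_toReal (hfin x)).symm
    calc ∫⁻ x, min (G x) M ∂(π : Measure X)
        = ∫⁻ t in Set.Ioi (0 : ℝ), (π : Measure X) {x | t < f x} := by
          simp_rw [hfG]
          exact lintegral_eq_lintegral_meas_lt _ (Eventually.of_forall hf0) hfm.aemeasurable
      _ ≤ ∫⁻ t in Set.Ioi (0 : ℝ), liminf (fun k => (πs k : Measure X) {x | t < f x}) atTop :=
          setLIntegral_mono' measurableSet_Ioi fun t ht =>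
            ProbabilityMeasure.le_liminf_measure_open_of_tendsto h (hopen t ht)
      _ ≤ liminf (fun k => ∫⁻ t in Set.Ioi (0 : ℝ), (πs k : Measure X) {x | t < f x}) atTop :=
          lintegral_liminf_le fun k => Antitone.measurable fun s t hst =>
            measure_mono fun x hx => lt_of_le_of_lt hst hx
      _ = liminf (fun k => ∫⁻ x, min (G x) M ∂(πs k : Measure X)) atTop := by
          simp_rw [hfG]
          congr 1
          funext k
          exact (lintegral_eq_lintegral_meas_lt _ (Eventually.of_forall hf0) hfm.aemeasurable).symm
      _ ≤ _ := liminf_le_liminf (Eventually.of_forall fun k =>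
          lintegral_mono fun x => min_le_left _ _)
  have hsup : ∫⁻ x, G x ∂(π : Measure X) = ⨆ M : ℕ, ∫⁻ x, min (G x) M ∂(π : Measure X) := by
    rw [← lintegral_iSup (fun M => hmeas.min measurable_const)]
    · congr 1
      funext x
      have : (⨆ M : ℕ, min (G x) (M : ℝ≥0∞)) = min (G x) (⨆ M : ℕ, (M : ℝ≥0∞)) := by
        simp only [inf_iSup_eq]
      rw [this, ENNReal.iSup_natCast, min_top_right]
    · intro M M' hM x
      exact min_le_min le_rfl (by exact_mod_cast hM)
  rw [hsup]
  exact iSup_le hcap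

theorem continuous_pev {a b : ℝ} {n : ℕ} (t : ℝ) :
    Continuous fun γ : CPath a b n => pev γ t := by
  unfold pev
  split_ifs with ht
  · exact ContinuousEvalConst.continuous_eval_const _
  · exact continuous_const

section ActionTopology

variable {n : ℕ} {a b : ℝ} {L : Eu n → Eu n → ℝ} {c₁ c₂ : ℝ}

/-- Sublevel sets of the action are closed. -/
theorem isClosed_action_le (hab : a ≤ b)
    (hL1 : ContDiff ℝ (⊤ : ℕ∞) (Function.uncurry L))
    (hL2 : ∀ K : Set (Eu n), IsCompact K → ∃ c₀ : ℝ, 0 < c₀ ∧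
      ∀ x ∈ K, ∀ v w : Eu n, c₀ * ‖w‖ ^ 2 ≤ fderiv ℝ (fderiv ℝ (L x)) v w w)
    (hc₁ : 0 < c₁) (hL3 : ∀ x v : Eu n, c₁ * ‖v‖ - c₂ ≤ L x v) (A : ℝ) :
    IsClosed {γ : CPath a b n | action L a b γ ≤ A} := by
  refine IsSeqClosed.isClosed fun γs γ hγs hlim => ?_
  have hstart := ((continuous_pev (a := a) (b := b) (n := n) a).tendsto γ).comp hlim
  obtain ⟨φ, hφ, γ', hγ', hA⟩ := exists_subseq_tendsto_action_le hab hL1 hL2 hc₁ hL3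
    hstart.isCompact_insert_range (A := A) (γs := γs)
    (fun k => Set.mem_insert_of_mem _ ⟨k, rfl⟩) hγs
  have : γ' = γ := tendsto_nhds_unique hγ' (hlim.comp hφ.tendsto_atTop)
  exact this ▸ hA

/-- Sublevel sets of the action with starting point in a compact set are compact. -/
theorem isCompact_action_le (hab : a ≤ b)
    (hL1 : ContDiff ℝ (⊤ : ℕ∞) (Function.uncurry L))
    (hL2 : ∀ K : Set (Eu n), IsCompact K → ∃ c₀ : ℝ, 0 < c₀ ∧
      ∀ x ∈ K, ∀ v w : Eu n, c₀ * ‖w‖ ^ 2 ≤ fderiv ℝ (fderiv ℝ (L x)) v w w)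
    (hc₁ : 0 < c₁) (hL3 : ∀ x v : Eu n, c₁ * ‖v‖ - c₂ ≤ L x v)
    {K : Set (Eu n)} (hK : IsCompact K) (A : ℝ) :
    IsCompact {γ : CPath a b n | pev γ a ∈ K ∧ action L a b γ ≤ A} := by
  refine IsSeqCompact.isCompact fun γs hγs => ?_
  obtain ⟨φ, hφ, γ, hγ, hA⟩ := exists_subseq_tendsto_action_le hab hL1 hL2 hc₁ hL3
    hK (A := A) (γs := γs) (fun k => (hγs k).1) (fun k => (hγs k).2)
  refine ⟨γ, ⟨?_, hA⟩, φ, hφ, hγ⟩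
  exact hK.isClosed.mem_of_tendsto (((continuous_pev a).tendsto γ).comp hγ)
    (Eventually.of_forall fun k => (hγs _).1)

end ActionTopology

theorem epos_le_ofReal_iff {x : EReal} {C : ℝ} (hC : 0 ≤ C) :
    epos x ≤ ENNReal.ofReal C ↔ x ≤ C := by
  induction x with
  | bot => simp [epos]
  | top => simp [epos]
  | coe x => simp [epos, ENNReal.ofReal_le_ofReal_iff hC]

theorem epos_add_eq {x : EReal} {B : ℝ} (hx : ((-B : ℝ) : EReal) ≤ x) (hB : 0 ≤ B) :
    epos x + ENNReal.ofReal B = epos (x + (B : EReal)) + epos (-x) := by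
  induction x with
  | bot => simp at hx
  | top => simp [epos]
  | coe x =>
    have hx' : -B ≤ x := by exact_mod_cast hx
    have h1 : epos (x : EReal) = ENNReal.ofReal x := by simp [epos]
    have h2 : epos (-(x : EReal)) = ENNReal.ofReal (-x) := by
      rw [← EReal.coe_neg]
      simp [epos, -EReal.coe_neg]
    have h3 : epos ((x : EReal) + B) = ENNReal.ofReal (x + B) := by
      rw [← EReal.coe_add]
      simp [epos, -EReal.coe_add]
    rw [h1, h2, h3]
    rcases le_total 0 x with h | h
    · rw [ENNReal.ofReal_of_nonpos (by linarith : -x ≤ 0), add_zero, ENNReal.ofReal_add h hB]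
    · rw [ENNReal.ofReal_of_nonpos h, zero_add, ← ENNReal.ofReal_add (by linarith) (by linarith)]
      congr 1; ring

theorem measurable_epos : Measurable epos := by
  unfold epos
  exact Measurable.ite (measurableSet_singleton _) measurable_const
    measurable_ereal_toReal.ennreal_ofReal

/-- The integral of an extended-real function bounded below by `-B`, computed by shifting. -/
theorem mint_eq_lintegral_sub {X : Type*} [MeasurableSpace X] {F : X → EReal} (hF : Measurable F)
    {B : ℝ} (hB : 0 ≤ B) (hFB : ∀ x, ((-B : ℝ) : EReal) ≤ F x) (π : Measure X)
    [IsProbabilityMeasure π] :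
    mint F π = ((∫⁻ x, epos (F x + (B : EReal)) ∂π : ℝ≥0∞) : EReal) - (B : EReal) := by
  have hmeas : Measurable fun x => epos (-(F x)) := measurable_epos.comp hF.neg
  have hsum : (∫⁻ x, epos (F x) ∂π) + ENNReal.ofReal B =
      (∫⁻ x, epos (F x + (B : EReal)) ∂π) + ∫⁻ x, epos (-(F x)) ∂π := by
    rw [← lintegral_add_right _ hmeas, ← lintegral_congr fun x => epos_add_eq (hFB x) hB,
      lintegral_add_right _ measurable_const]
    simp
  have hneg : ∫⁻ x, epos (-(F x)) ∂π ≤ ENNReal.ofReal B := by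
    calc ∫⁻ x, epos (-(F x)) ∂π ≤ ∫⁻ _, ENNReal.ofReal B ∂π := lintegral_mono fun x => by
          rw [epos_le_ofReal_iff hB, EReal.neg_le]
          simpa using hFB x
      _ = ENNReal.ofReal B := by simp
  have hnt : ∫⁻ x, epos (-(F x)) ∂π ≠ ⊤ := ne_top_of_le_ne_top ENNReal.ofReal_ne_top hneg
  rw [mint]
  generalize (∫⁻ x, epos (F x) ∂π) = p at *
  generalize (∫⁻ x, epos (F x + (B : EReal)) ∂π) = q at *
  generalize (∫⁻ x, epos (-(F x)) ∂π) = r at *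
  lift r to ℝ≥0 using hnt
  induction q with
  | top =>
    have : p = ⊤ := by
      by_contra hp
      have : p + ENNReal.ofReal B ≠ ⊤ := by simp [hp]
      rw [hsum] at this
      simp at this
    rw [this]
    have h1 : ((r : ℝ≥0∞) : EReal) = ((r : ℝ) : EReal) := rfl
    rw [h1, EReal.coe_ennreal_top, EReal.top_sub_coe, EReal.top_sub_coe]
  | coe q =>
    have hp : p ≠ ⊤ := by
      rintro rfl
      rw [top_add] at hsum
      exact absurd hsum.symm (by simp)
    lift p to ℝ≥0 using hp
    have h1 : (p : ℝ) + B = q + r := by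
      have := congrArg ENNReal.toReal hsum
      rw [ENNReal.toReal_add (by simp) (by simp), ENNReal.toReal_add (by simp) (by simp),
        ENNReal.toReal_ofReal hB] at this
      simpa using this
    change (((p : ℝ) : EReal)) - ((r : ℝ) : EReal) = ((q : ℝ) : EReal) - (B : EReal)
    rw [← EReal.coe_sub, ← EReal.coe_sub]
    congr 1
    linarith

/-- The properties of the action functional needed for the direct method: it is bounded below
by `-B`, its sublevel sets are closed, and they become compact once the starting point is
confined to a compact set. -/
structure IsCoerciveFunctional {a b : ℝ} {n : ℕ} (F : CPath a b n → EReal) (B : ℝ) : Prop where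
  nonneg : 0 ≤ B
  lower : ∀ γ, ((-B : ℝ) : EReal) ≤ F γ
  isClosed_le : ∀ A : ℝ, IsClosed {γ | F γ ≤ A}
  isCompact_le : ∀ K : Set (Eu n), IsCompact K → ∀ A : ℝ,
    IsCompact {γ | pev γ a ∈ K ∧ F γ ≤ A}

theorem isCoerciveFunctional_action {n : ℕ} {a b : ℝ} {L : Eu n → Eu n → ℝ} {c₁ c₂ : ℝ}
    (hab : a ≤ b) (hL1 : ContDiff ℝ (⊤ : ℕ∞) (Function.uncurry L))
    (hL2 : ∀ K : Set (Eu n), IsCompact K → ∃ c₀ : ℝ, 0 < c₀ ∧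
      ∀ x ∈ K, ∀ v w : Eu n, c₀ * ‖w‖ ^ 2 ≤ fderiv ℝ (fderiv ℝ (L x)) v w w)
    (hc₁ : 0 < c₁) (hc₂ : 0 ≤ c₂) (hL3 : ∀ x v : Eu n, c₁ * ‖v‖ - c₂ ≤ L x v) :
    IsCoerciveFunctional (action L a b) (c₂ * (b - a)) where
  nonneg := mul_nonneg hc₂ (sub_nonneg.2 hab)
  lower _ := lower_bound_action hab hc₁ hL3
  isClosed_le := isClosed_action_le hab hL1 hL2 hc₁ hL3
  isCompact_le _ hK := isCompact_action_le hab hL1 hL2 hc₁ hL3 hK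

namespace IsCoerciveFunctional

variable {a b : ℝ} {n : ℕ} {F : CPath a b n → EReal} {B : ℝ}

theorem measurable (hF : IsCoerciveFunctional F B) : Measurable F := by
  refine LowerSemicontinuous.measurable ?_
  rw [lowerSemicontinuous_iff_isClosed_preimage]
  intro c
  induction c with
  | bot =>
    have : F ⁻¹' Set.Iic ⊥ = ∅ := by
      ext γ
      simp only [Set.mem_preimage, Set.mem_Iic, Set.mem_empty_iff_false, iff_false]
      exact fun h => absurd ((hF.lower γ).trans h) (by simp)
    rw [this]
    exact isClosed_empty
  | top => simp
  | coe c => exact hF.isClosed_le c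

theorem shift_le_iff {C : ℝ} (hC : 0 ≤ C) {γ : CPath a b n} :
    epos (F γ + (B : EReal)) ≤ ENNReal.ofReal C ↔ F γ ≤ ((C - B : ℝ) : EReal) := by
  rw [epos_le_ofReal_iff hC, EReal.coe_sub, EReal.le_sub_iff_add_le] <;> simp

theorem lowerSemicontinuous_shift (hF : IsCoerciveFunctional F B) :
    LowerSemicontinuous fun γ => epos (F γ + (B : EReal)) := by
  rw [lowerSemicontinuous_iff_isClosed_preimage]
  intro c
  rcases eq_or_ne c ⊤ with rfl | hc
  · simp
  · have : (fun γ => epos (F γ + (B : EReal))) ⁻¹' Set.Iic c =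
        {γ | F γ ≤ ((c.toReal - B : ℝ) : EReal)} := by
      ext γ
      rw [Set.mem_preimage, Set.mem_Iic, Set.mem_ofPred_eq,
        ← shift_le_iff ENNReal.toReal_nonneg, ENNReal.ofReal_toReal hc]
    rw [this]
    exact hF.isClosed_le _

theorem mint_le_iff (hF : IsCoerciveFunctional F B) (π : Measure (CPath a b n))
    [IsProbabilityMeasure π] {C : ℝ} :
    mint F π ≤ C ↔
      0 ≤ C + B ∧ ∫⁻ γ, epos (F γ + (B : EReal)) ∂π ≤ ENNReal.ofReal (C + B) := by
  rw [mint_eq_lintegral_sub hF.measurable hF.nonneg hF.lower,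
    EReal.sub_le_iff_le_add (by simp) (by simp), ← EReal.coe_add]
  generalize (∫⁻ γ, epos (F γ + (B : EReal)) ∂π) = q
  constructor
  · intro h
    have h0 : 0 ≤ C + B := by
      have : (0 : EReal) ≤ ((C + B : ℝ) : EReal) := (EReal.coe_ennreal_nonneg q).trans h
      exact_mod_cast this
    refine ⟨h0, ?_⟩
    rw [← EReal.coe_ennreal_le_coe_ennreal_iff, EReal.coe_ennreal_ofReal, max_eq_left h0]
    exact h
  · rintro ⟨h0, h⟩
    rwa [← EReal.coe_ennreal_le_coe_ennreal_iff, EReal.coe_ennreal_ofReal, max_eq_left h0] at h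

theorem aFun_le_iff (hF : IsCoerciveFunctional F B) {μ ν : Measure (Eu n)}
    (π : Measure (CPath a b n)) [IsProbabilityMeasure π] {C : ℝ} :
    aFun F μ ν π ≤ C ↔ (Measure.map (fun γ => pev γ a) π = μ ∧
      Measure.map (fun γ => pev γ b) π = ν) ∧
      0 ≤ C + B ∧ ∫⁻ γ, epos (F γ + (B : EReal)) ∂π ≤ ENNReal.ofReal (C + B) := by
  unfold aFun
  split_ifs with h
  · rw [hF.mint_le_iff]
    exact ⟨fun h' => ⟨h, h'⟩, fun h' => h'.2⟩
  · simp [h]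

theorem lower_bound_aFun (hF : IsCoerciveFunctional F B) {μ ν : Measure (Eu n)}
    (π : Measure (CPath a b n)) [IsProbabilityMeasure π] :
    ((-B : ℝ) : EReal) ≤ aFun F μ ν π := by
  by_contra! h
  obtain ⟨c, h1, h2⟩ := EReal.lt_iff_exists_real_btwn.1 h
  have := ((hF.aFun_le_iff π).1 h1.le).2.1
  have h3 : c < -B := by exact_mod_cast h2
  linarith

/-- Probability measures with uniformly bounded `aFun` and first marginals supported in a common
compact set have a weakly convergent subsequence. -/
theorem exists_subseq_tendsto (hF : IsCoerciveFunctional F B) {K : Set (Eu n)}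
    (hK : IsCompact K) {μs νs : ℕ → Measure (Eu n)} (hμ : ∀ k, μs k Kᶜ = 0)
    {πs : ℕ → ProbabilityMeasure (CPath a b n)} {C : ℝ}
    (hC : ∀ k, aFun F (μs k) (νs k) (πs k : Measure (CPath a b n)) ≤ C) :
    ∃ φ : ℕ → ℕ, StrictMono φ ∧ ∃ π, Tendsto (πs ∘ φ) atTop (𝓝 π) := by
  have htight : IsTightMeasureSet
      {((π : ProbabilityMeasure (CPath a b n)) : Measure (CPath a b n)) | π ∈ Set.range πs} := by
    rw [isTightMeasureSet_iff_exists_isCompact_measure_compl_le]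
    intro ε hε
    obtain ⟨m, hm⟩ := ENNReal.exists_nat_mul_gt hε.ne' (ENNReal.ofReal_ne_top (r := C + B))
    refine ⟨_, hF.isCompact_le K hK (m - B), ?_⟩
    rintro _ ⟨_, ⟨k, rfl⟩, rfl⟩
    obtain ⟨⟨h1, -⟩, h0, h2⟩ := (hF.aFun_le_iff _).1 (hC k)
    have hsub : {γ : CPath a b n | pev γ a ∈ K ∧ F γ ≤ ((m - B : ℝ) : EReal)}ᶜ ⊆
        (fun γ : CPath a b n => pev γ a) ⁻¹' Kᶜ ∪ {γ | (m : ℝ≥0∞) ≤ epos (F γ + (B : EReal))} := by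
      intro γ hγ
      by_cases ha : pev γ a ∈ K
      · right
        have hγ' : ¬ F γ ≤ ((m - B : ℝ) : EReal) := fun h => hγ ⟨ha, h⟩
        rw [← shift_le_iff (Nat.cast_nonneg m), ENNReal.ofReal_natCast, not_le] at hγ'
        exact hγ'.le
      · exact Or.inl ha
    have hz : (πs k : Measure (CPath a b n)) ((fun γ : CPath a b n => pev γ a) ⁻¹' Kᶜ) = 0 := by
      rw [← Measure.map_apply (continuous_pev a).measurable hK.isClosed.measurableSet.compl, h1, hμ]
    have hm0 : (m : ℝ≥0∞) ≠ 0 := by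
      rintro h
      rw [h, zero_mul] at hm
      exact not_lt_zero hm
    calc (πs k : Measure (CPath a b n)) _ ≤ _ := measure_mono hsub
      _ ≤ _ := measure_union_le _ _
      _ ≤ 0 + (∫⁻ γ, epos (F γ + (B : EReal)) ∂(πs k : Measure (CPath a b n))) / m := by
        rw [hz]
        gcongr
        exact meas_ge_le_lintegral_div hF.lowerSemicontinuous_shift.measurable.aemeasurable hm0
          (ENNReal.natCast_ne_top m)
      _ ≤ ε := by
        rw [zero_add]
        refine ENNReal.div_le_of_le_mul ?_
        rw [mul_comm]
        exact h2.trans hm.le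
  have hcomp := isCompact_closure_of_isTightMeasureSet htight
  obtain ⟨π, -, φ, hφ, hlim⟩ := hcomp.isSeqCompact (x := πs) fun k => subset_closure ⟨k, rfl⟩
  exact ⟨φ, hφ, π, hlim⟩

/-- Marginals pass to weak limits. -/
theorem map_pev_eq_of_tendsto {μs : ℕ → Measure (Eu n)} {μ : Measure (Eu n)}
    [IsFiniteMeasure μ] (hμ : WeakLim μs μ) {πs : ℕ → ProbabilityMeasure (CPath a b n)}
    {π : ProbabilityMeasure (CPath a b n)} (h : Tendsto πs atTop (𝓝 π)) (t : ℝ)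
    (hs : ∀ k, Measure.map (fun γ => pev γ t) (πs k : Measure (CPath a b n)) = μs k) :
    Measure.map (fun γ => pev γ t) (π : Measure (CPath a b n)) = μ := by
  have hc := continuous_pev (a := a) (b := b) (n := n) t
  have : IsFiniteMeasure (Measure.map (fun γ => pev γ t) (π : Measure (CPath a b n))) :=
    Measure.isFiniteMeasure_map _ _
  refine ext_of_forall_integral_eq_of_IsFiniteMeasure fun f => ?_
  have key : ∀ ρ : ProbabilityMeasure (CPath a b n),
      ∫ x, f x ∂(Measure.map (fun γ => pev γ t) (ρ : Measure (CPath a b n))) =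
        ∫ γ, (f.compContinuous ⟨_, hc⟩) γ ∂(ρ : Measure (CPath a b n)) := fun ρ =>
    integral_map hc.measurable.aemeasurable f.continuous.aestronglyMeasurable
  refine tendsto_nhds_unique ?_ (hμ f)
  simp_rw [← hs, key]
  exact ProbabilityMeasure.tendsto_iff_forall_integral_tendsto.1 h _

/-- Upper bounds on `aFun` pass to weak limits. -/
theorem aFun_le_of_tendsto (hF : IsCoerciveFunctional F B) {μs νs : ℕ → Measure (Eu n)}
    {μ ν : Measure (Eu n)} [IsFiniteMeasure μ] [IsFiniteMeasure ν] (hμ : WeakLim μs μ)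
    (hν : WeakLim νs ν) {πs : ℕ → ProbabilityMeasure (CPath a b n)}
    {π : ProbabilityMeasure (CPath a b n)} (h : Tendsto πs atTop (𝓝 π)) {C : ℝ}
    (hC : ∀ k, aFun F (μs k) (νs k) (πs k : Measure (CPath a b n)) ≤ C) :
    aFun F μ ν (π : Measure (CPath a b n)) ≤ C := by
  rw [hF.aFun_le_iff]
  have hC' := fun k => (hF.aFun_le_iff _).1 (hC k)
  refine ⟨⟨map_pev_eq_of_tendsto hμ h a fun k => (hC' k).1.1,
    map_pev_eq_of_tendsto hν h b fun k => (hC' k).1.2⟩, (hC' 0).2.1, ?_⟩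
  refine (lintegral_le_liminf_lintegral_of_lowerSemicontinuous h
    hF.lowerSemicontinuous_shift).trans ?_
  exact liminf_le_of_le (by isBoundedDefault) fun c hc => by
    obtain ⟨k, hk⟩ := hc.exists
    exact hk.trans (hC' k).2.2

/-- The direct method: minimizers of `aFun` exist. -/
theorem exists_minimizer (hF : IsCoerciveFunctional F B) {K : Set (Eu n)} (hK : IsCompact K)
    {μ ν : Measure (Eu n)} [IsFiniteMeasure μ] [IsFiniteMeasure ν] (hμ : μ Kᶜ = 0) :
    ∃ π : ProbabilityMeasure (CPath a b n), ∀ π' : ProbabilityMeasure (CPath a b n),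
      aFun F μ ν (π : Measure (CPath a b n)) ≤ aFun F μ ν (π' : Measure (CPath a b n)) := by
  suffices h : ∃ π : ProbabilityMeasure (CPath a b n), aFun F μ ν (π : Measure (CPath a b n)) ≤
      ⨅ π' : ProbabilityMeasure (CPath a b n), aFun F μ ν (π' : Measure (CPath a b n)) by
    obtain ⟨π, hπ⟩ := h
    exact ⟨π, fun π' => hπ.trans (iInf_le _ π')⟩
  set I := ⨅ π' : ProbabilityMeasure (CPath a b n), aFun F μ ν (π' : Measure (CPath a b n))
    with hI
  rcases eq_or_ne I ⊤ with h | h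
  · exact ⟨⟨Measure.dirac 0, inferInstance⟩, by rw [h]; exact le_top⟩
  have hlow : ((-B : ℝ) : EReal) ≤ I := le_iInf fun π => hF.lower_bound_aFun _
  have hbot : I ≠ ⊥ := fun h' => by rw [h'] at hlow; simp at hlow
  lift I to ℝ using ⟨h, hbot⟩ with r
  have hex : ∀ k : ℕ, ∃ π : ProbabilityMeasure (CPath a b n),
      aFun F μ ν (π : Measure (CPath a b n)) < ((r + 1 / (k + 1 : ℝ) : ℝ) : EReal) := by
    intro k
    rw [← iInf_lt_iff, ← hI]
    have : r < r + 1 / (k + 1 : ℝ) := by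
      have : (0 : ℝ) < 1 / (k + 1 : ℝ) := by positivity
      linarith
    exact_mod_cast this
  choose πs hπs using hex
  obtain ⟨φ, hφ, π, hπ⟩ := hF.exists_subseq_tendsto hK (μs := fun _ => μ) (νs := fun _ => ν)
    (fun _ => hμ) (πs := πs) (C := r + 1) fun k => (hπs k).le.trans (by
      have : (1 : ℝ) / (k + 1 : ℝ) ≤ 1 := by
        rw [div_le_one (by positivity)]
        linarith [(Nat.cast_nonneg k : (0 : ℝ) ≤ k)]
      exact EReal.coe_le_coe_iff.2 (by linarith))
  refine ⟨π, ?_⟩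
  refine EReal.le_of_forall_lt_iff_le.1 fun z hz => ?_
  have hz' : r < z := by exact_mod_cast hz
  have hev : ∀ᶠ k in atTop, r + 1 / ((φ k : ℕ) + 1 : ℝ) < z := by
    have : Tendsto (fun k => r + 1 / ((φ k : ℕ) + 1 : ℝ)) atTop (𝓝 (r + 0)) :=
      (tendsto_one_div_add_atTop_nhds_zero_nat.comp hφ.tendsto_atTop).const_add r
    rw [add_zero] at this
    exact this.eventually_lt_const hz'
  obtain ⟨k₀, hk₀⟩ := eventually_atTop.1 hev
  refine hF.aFun_le_of_tendsto (μs := fun _ => μ) (νs := fun _ => ν)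
    (fun _ => tendsto_const_nhds) (fun _ => tendsto_const_nhds)
    (hπ.comp (tendsto_add_atTop_nat k₀)) fun k => ?_
  refine (hπs _).le.trans ?_
  exact_mod_cast (hk₀ (k + k₀) (by omega)).le

end IsCoerciveFunctional

/-- Normalizing the masses `α i` within each cell `i`. -/
theorem normalized_weights {ι κ : Type*} [Fintype ι] [Fintype κ] {lam : ℝ} (hlam0 : 0 < lam)
    {α : ι → κ → ℝ} {R : ι → ι → ℝ} (hα : ∀ i k, 0 ≤ α i k) (hR : ∀ i j, 0 ≤ R i j)
    (hRα : ∀ i, lam * ∑ j, R i j ≤ ∑ k, α i k) :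
    (∀ i j, ∑ k, R i j * (α i k / ∑ k', α i k') = R i j) ∧
      (∀ i, ∑ k, α i k / ∑ k', α i k' ≤ 1) ∧
      ∀ k, lam * ∑ i, (∑ j, R i j) * (α i k / ∑ k', α i k') ≤ ∑ i, α i k := by
  refine ⟨fun i j => ?_, fun i => ?_, fun k => ?_⟩
  · rw [← Finset.mul_sum, ← Finset.sum_div]
    rcases eq_or_ne (∑ k', α i k') 0 with h | h
    · have h1 : ∑ j, R i j ≤ 0 := by
        have := hRα i
        rw [h] at this
        by_contra! h2
        exact absurd (mul_pos hlam0 h2) (not_lt.2 this)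
      have h2 : R i j = 0 := le_antisymm
        ((Finset.single_le_sum (fun j _ => hR i j) (Finset.mem_univ j)).trans h1) (hR i j)
      rw [h2, zero_mul]
    · rw [div_self h, mul_one]
  · rw [← Finset.sum_div]
    exact div_self_le_one _
  · rw [Finset.mul_sum]
    refine Finset.sum_le_sum fun i _ => ?_
    have hs : 0 ≤ ∑ k', α i k' := Finset.sum_nonneg fun k _ => hα i k
    rcases hs.eq_or_lt with h | h
    · rw [← h, div_zero, mul_zero, mul_zero]
      exact hα i k
    · calc lam * ((∑ j, R i j) * (α i k / ∑ k', α i k'))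
          = (lam * ∑ j, R i j) * (α i k / ∑ k', α i k') := by ring
        _ ≤ (∑ k', α i k') * (α i k / ∑ k', α i k') :=
          mul_le_mul_of_nonneg_right (hRα i) (div_nonneg (hα i k) h.le)
        _ = α i k := by field_simp

/-- A transport plan `P` between coarse cells can be turned into an exact plan `w` between finer
marginals `∑ i, α i` and `∑ j, β j`, as soon as the cell masses dominate `lam` times the marginals
of `P`; the defect is distributed independently at price `(1 - lam) * C`. -/
theorem exists_transport_weights {ι κ κ' : Type*} [Fintype ι] [Fintype κ] [Fintype κ']
    {lam : ℝ} (hlam0 : 0 < lam) (hlam1 : lam < 1) {P Q : ι → ι → ℝ} (hP : ∀ i j, 0 ≤ P i j)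
    (hQ : ∀ i j, 0 ≤ Q i j) (hP1 : ∑ i, ∑ j, P i j = 1) {α : ι → κ → ℝ} {β : ι → κ' → ℝ}
    (hα : ∀ i k, 0 ≤ α i k) (hβ : ∀ j l, 0 ≤ β j l)
    (hα1 : ∑ k, ∑ i, α i k = 1) (hβ1 : ∑ l, ∑ j, β j l = 1)
    (hPα : ∀ i, lam * ∑ j, P i j ≤ ∑ k, α i k) (hPβ : ∀ j, lam * ∑ i, P i j ≤ ∑ l, β j l)
    {c : κ → κ' → ℝ} {C : ℝ} (hc : ∀ k l, c k l ≤ C)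
    (hPQ : ∀ i j k l, 0 < α i k → 0 < β j l → P i j * c k l ≤ Q i j) :
    ∃ w : κ → κ' → ℝ, (∀ k l, 0 ≤ w k l) ∧ (∀ k, ∑ l, w k l = ∑ i, α i k) ∧
      (∀ l, ∑ k, w k l = ∑ j, β j l) ∧
      ∑ k, ∑ l, w k l * c k l ≤ ∑ i, ∑ j, Q i j + (1 - lam) * C := by
  obtain ⟨ht1, ht2, ht3⟩ := normalized_weights hlam0 hα hP hPα
  obtain ⟨hs1, hs2, hs3⟩ := normalized_weights (R := fun j i => P i j) hlam0 hβ (fun j i => hP i j) hPβ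
  set t : ι → κ → ℝ := fun i k => α i k / ∑ k', α i k' with ht
  set s : ι → κ' → ℝ := fun j l => β j l / ∑ l', β j l' with hs
  have ht0 : ∀ i k, 0 ≤ t i k := fun i k =>
    div_nonneg (hα i k) (Finset.sum_nonneg fun k _ => hα i k)
  have hs0 : ∀ j l, 0 ≤ s j l := fun j l =>
    div_nonneg (hβ j l) (Finset.sum_nonneg fun l _ => hβ j l)
  change ∀ i j, ∑ k, P i j * t i k = P i j at ht1
  change ∀ j i, ∑ l, P i j * s j l = P i j at hs1
  change ∀ k, lam * ∑ i, (∑ j, P i j) * t i k ≤ ∑ i, α i k at ht3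
  change ∀ l, lam * ∑ j, (∑ i, P i j) * s j l ≤ ∑ j, β j l at hs3
  set r : κ → ℝ := fun k => ∑ i, α i k - lam * ∑ i, (∑ j, P i j) * t i k with hr
  set q : κ' → ℝ := fun l => ∑ j, β j l - lam * ∑ j, (∑ i, P i j) * s j l with hq
  have hr0 : ∀ k, 0 ≤ r k := fun k => sub_nonneg.2 (ht3 k)
  have hq0 : ∀ l, 0 ≤ q l := fun l => sub_nonneg.2 (hs3 l)
  have hrsum : ∑ k, r k = 1 - lam := by
    have : ∑ k, ∑ i, (∑ j, P i j) * t i k = 1 := by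
      rw [Finset.sum_comm, ← hP1]
      refine Finset.sum_congr rfl fun i _ => ?_
      simp_rw [Finset.sum_mul]
      rw [Finset.sum_comm]
      exact Finset.sum_congr rfl fun j _ => ht1 i j
    simp only [hr, Finset.sum_sub_distrib, ← Finset.mul_sum, hα1, this, mul_one]
  have hqsum : ∑ l, q l = 1 - lam := by
    have : ∑ l, ∑ j, (∑ i, P i j) * s j l = 1 := by
      rw [Finset.sum_comm, ← hP1, Finset.sum_comm (f := fun i j => P i j)]
      refine Finset.sum_congr rfl fun j _ => ?_
      simp_rw [Finset.sum_mul]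
      rw [Finset.sum_comm]
      exact Finset.sum_congr rfl fun i _ => hs1 j i
    simp only [hq, Finset.sum_sub_distrib, ← Finset.mul_sum, hβ1, this, mul_one]
  have hlam : 0 < 1 - lam := sub_pos.2 hlam1
  refine ⟨fun k l => lam * ∑ i, ∑ j, P i j * t i k * s j l + r k * q l / (1 - lam),
    fun k l => ?_, fun k => ?_, fun l => ?_, ?_⟩
  · refine add_nonneg (mul_nonneg hlam0.le (Finset.sum_nonneg fun i _ => Finset.sum_nonneg
      fun j _ => mul_nonneg (mul_nonneg (hP i j) (ht0 i k)) (hs0 j l))) ?_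
    exact div_nonneg (mul_nonneg (hr0 k) (hq0 l)) hlam.le
  · have h1 : ∑ l, ∑ i, ∑ j, P i j * t i k * s j l = ∑ i, (∑ j, P i j) * t i k := by
      rw [Finset.sum_comm]
      refine Finset.sum_congr rfl fun i _ => ?_
      rw [Finset.sum_comm, Finset.sum_mul]
      refine Finset.sum_congr rfl fun j _ => ?_
      calc ∑ l, P i j * t i k * s j l = (∑ l, P i j * s j l) * t i k := by
            rw [Finset.sum_mul]
            exact Finset.sum_congr rfl fun l _ => by ring
        _ = P i j * t i k := by rw [hs1]
    rw [Finset.sum_add_distrib, ← Finset.mul_sum, h1, ← Finset.sum_div, ← Finset.mul_sum, hqsum,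
      mul_div_assoc, div_self hlam.ne', mul_one]
    simp only [hr]
    ring
  · have h1 : ∑ k, ∑ i, ∑ j, P i j * t i k * s j l = ∑ j, (∑ i, P i j) * s j l := by
      rw [Finset.sum_comm]
      simp_rw [Finset.sum_mul]
      rw [Finset.sum_comm (f := fun j i => P i j * s j l)]
      refine Finset.sum_congr rfl fun i _ => ?_
      rw [Finset.sum_comm]
      refine Finset.sum_congr rfl fun j _ => ?_
      rw [← Finset.sum_mul, ht1]
    rw [Finset.sum_add_distrib, ← Finset.mul_sum, h1, ← Finset.sum_div, ← Finset.sum_mul, hrsum,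
      mul_div_right_comm, div_self hlam.ne', one_mul]
    simp only [hq]
    ring
  · have hterm : ∀ i j k l, P i j * t i k * s j l * c k l ≤ Q i j * (t i k * s j l) := by
      intro i j k l
      rcases (hα i k).eq_or_lt with h | h
      · have : t i k = 0 := by simp only [ht, ← h, zero_div]
        simp [this]
      rcases (hβ j l).eq_or_lt with h' | h'
      · have : s j l = 0 := by simp only [hs, ← h', zero_div]
        simp [this]
      calc P i j * t i k * s j l * c k l = P i j * c k l * (t i k * s j l) := by ring
        _ ≤ _ := mul_le_mul_of_nonneg_right (hPQ i j k l h h') (mul_nonneg (ht0 _ _) (hs0 _ _))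
    have hsum1 : ∑ k, ∑ l, (∑ i, ∑ j, P i j * t i k * s j l) * c k l ≤ ∑ i, ∑ j, Q i j := by
      calc ∑ k, ∑ l, (∑ i, ∑ j, P i j * t i k * s j l) * c k l
          ≤ ∑ k, ∑ l, ∑ i, ∑ j, Q i j * (t i k * s j l) := by
            refine Finset.sum_le_sum fun k _ => Finset.sum_le_sum fun l _ => ?_
            simp_rw [Finset.sum_mul]
            exact Finset.sum_le_sum fun i _ => Finset.sum_le_sum fun j _ => hterm i j k l
        _ = ∑ i, ∑ j, Q i j * ((∑ k, t i k) * ∑ l, s j l) := by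
            simp_rw [Finset.sum_mul_sum, Finset.mul_sum]
            calc ∑ k, ∑ l, ∑ i, ∑ j, Q i j * (t i k * s j l)
                = ∑ k, ∑ i, ∑ l, ∑ j, Q i j * (t i k * s j l) :=
                  Finset.sum_congr rfl fun k _ => Finset.sum_comm
              _ = ∑ i, ∑ k, ∑ l, ∑ j, Q i j * (t i k * s j l) := Finset.sum_comm
              _ = ∑ i, ∑ k, ∑ j, ∑ l, Q i j * (t i k * s j l) :=
                  Finset.sum_congr rfl fun i _ => Finset.sum_congr rfl fun k _ => Finset.sum_comm
              _ = _ := Finset.sum_congr rfl fun i _ => Finset.sum_comm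
        _ ≤ ∑ i, ∑ j, Q i j := by
            refine Finset.sum_le_sum fun i _ => Finset.sum_le_sum fun j _ => ?_
            refine mul_le_of_le_one_right (hQ i j) ?_
            exact mul_le_one₀ (ht2 i) (Finset.sum_nonneg fun l _ => hs0 j l) (hs2 j)
    have hsum2 : ∑ k, ∑ l, r k * q l / (1 - lam) * c k l ≤ (1 - lam) * C := by
      calc ∑ k, ∑ l, r k * q l / (1 - lam) * c k l
          ≤ ∑ k, ∑ l, r k * q l / (1 - lam) * C :=
            Finset.sum_le_sum fun k _ => Finset.sum_le_sum fun l _ =>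
              mul_le_mul_of_nonneg_left (hc k l) (div_nonneg (mul_nonneg (hr0 k) (hq0 l)) hlam.le)
        _ = (∑ k, r k) * (∑ l, q l) / (1 - lam) * C := by
            simp_rw [Finset.sum_mul_sum, Finset.sum_div, Finset.sum_mul]
        _ = (1 - lam) * C := by
            rw [hrsum, hqsum, mul_div_assoc, div_self hlam.ne', mul_one]
    have hQ0 : 0 ≤ ∑ i, ∑ j, Q i j :=
      Finset.sum_nonneg fun i _ => Finset.sum_nonneg fun j _ => hQ i j
    calc _ = lam * (∑ k, ∑ l, (∑ i, ∑ j, P i j * t i k * s j l) * c k l) +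
          ∑ k, ∑ l, r k * q l / (1 - lam) * c k l := by
          simp_rw [add_mul, Finset.sum_add_distrib, mul_assoc lam, ← Finset.mul_sum]
      _ ≤ lam * (∑ i, ∑ j, Q i j) + (1 - lam) * C :=
          add_le_add (mul_le_mul_of_nonneg_left hsum1 hlam0.le) hsum2
      _ ≤ _ := by
          gcongr
          exact mul_le_of_le_one_left hQ0 hlam1.le

/-- A compact set carries finite continuous partitions of unity of arbitrarily small mesh. -/
theorem exists_partition_of_small_diam {E : Type*} [MetricSpace E] {K : Set E} (hK : IsCompact K)
    {δ : ℝ} (hδ : 0 < δ) :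
    ∃ (m : ℕ) (f : Fin m → C(E, ℝ)), (∀ i x, 0 ≤ f i x) ∧ (∀ i x, f i x ≤ 1) ∧
      (∀ x ∈ K, ∑ i, f i x = 1) ∧ ∀ i x y, 0 < f i x → 0 < f i y → dist x y < δ := by
  obtain ⟨t, -, htfin, hcov⟩ := hK.finite_cover_balls (half_pos hδ)
  have : Finite t := htfin
  obtain ⟨m, ⟨e⟩⟩ := Finite.exists_equiv_fin t
  obtain ⟨f, hf⟩ := PartitionOfUnity.exists_isSubordinate_of_locallyFinite hK.isClosed
    (fun i : Fin m => Metric.ball ((e.symm i : t) : E) (δ / 2)) (fun i => Metric.isOpen_ball)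
    (locallyFinite_of_finite _) (by
      intro x hx
      obtain ⟨z, hz, hxz⟩ := Set.mem_iUnion₂.1 (hcov hx)
      exact Set.mem_iUnion.2 ⟨e ⟨z, hz⟩, by simpa using hxz⟩)
  have hball : ∀ i x, 0 < f i x → dist x ((e.symm i : t) : E) < δ / 2 := fun i x hx =>
    hf i (subset_tsupport _ hx.ne')
  refine ⟨m, fun i => f i, fun i x => f.nonneg i x, fun i x => f.le_one i x, fun x hx => ?_,
    fun i x y hx hy => ?_⟩
  · rw [← finsum_eq_sum_of_fintype]
    exact f.sum_eq_one hx
  · calc dist x y ≤ dist x ((e.symm i : t) : E) + dist y ((e.symm i : t) : E) :=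
        dist_triangle_right _ _ _
      _ < δ := by linarith [hball i x hx, hball i y hy]

/-- Integration against an empirical measure is averaging. -/
theorem integral_emp {X : Type*} [MeasurableSpace X] [MeasurableSingletonClass X] (N : ℕ)
    (x : Fin N → X) (f : X → ℝ) : ∫ z, f z ∂(emp N x) = ∑ k, f (x k) / N := by
  rw [emp, integral_smul_measure, integral_finsetSum_measure]
  · simp only [integral_dirac, ENNReal.toReal_inv, ENNReal.toReal_natCast, smul_eq_mul,
      Finset.mul_sum]
    exact Finset.sum_congr rfl fun k _ => by rw [div_eq_inv_mul]
  · exact fun i _ => integrable_dirac (by simp)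

/-- Averages of a bounded nonnegative continuous function eventually dominate any fraction of the
limiting integral. -/
theorem eventually_mul_integral_le_emp {E : Type*} [MetricSpace E] [MeasurableSpace E]
    [BorelSpace E] {μ : Measure E} {x : (N : ℕ) → Fin N → E}
    (hx : WeakLim (fun N => emp N (x N)) μ) {f : C(E, ℝ)} (hf0 : ∀ z, 0 ≤ f z)
    (hf1 : ∀ z, f z ≤ 1) {lam : ℝ} (hlam1 : lam < 1) :
    ∀ᶠ N : ℕ in atTop, lam * ∫ z, f z ∂μ ≤ ∑ k, f (x N k) / N := by
  have hnn : 0 ≤ ∫ z, f z ∂μ := integral_nonneg hf0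
  rcases hnn.eq_or_lt with h | h
  · refine Eventually.of_forall fun N => ?_
    rw [← h, mul_zero]
    exact Finset.sum_nonneg fun k _ => div_nonneg (hf0 _) (Nat.cast_nonneg N)
  · have hlim := hx (BoundedContinuousFunction.ofNormedAddCommGroup f f.continuous 1 fun z => by
      rw [Real.norm_of_nonneg (hf0 z)]
      exact hf1 z)
    simp only [BoundedContinuousFunction.coe_ofNormedAddCommGroup, integral_emp] at hlim
    have : lam * ∫ z, f z ∂μ < ∫ z, f z ∂μ := mul_lt_of_lt_one_left h hlam1
    exact (hlim.eventually_const_lt this).mono fun N hN => hN.le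

/-- Any plan between `μ` and `ν` can be approximated in cost by plans between the empirical
measures. -/
theorem eventually_exists_transport_weights {E : Type*} [MetricSpace E]
    [SecondCountableTopology E] [MeasurableSpace E] [BorelSpace E] {K : Set E} (hK : IsCompact K)
    {μ ν : Measure E} {x y : (N : ℕ) → Fin N → E} (hxK : ∀ N i, x N i ∈ K)
    (hyK : ∀ N i, y N i ∈ K) (hx : WeakLim (fun N => emp N (x N)) μ)
    (hy : WeakLim (fun N => emp N (y N)) ν) (p : Measure (E × E)) [IsProbabilityMeasure p]
    (hpμ : p.map Prod.fst = μ) (hpν : p.map Prod.snd = ν)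
    (hpK : ∀ᵐ z ∂p, z.1 ∈ K ∧ z.2 ∈ K) {c : E × E → ℝ} (hc : Continuous c) {C : ℝ}
    (hc0 : ∀ z, 0 ≤ c z) (hcC : ∀ z, c z ≤ C) {ε : ℝ} (hε : 0 < ε) :
    ∀ᶠ N : ℕ in atTop, ∃ w : Fin N → Fin N → ℝ, (∀ k l, 0 ≤ w k l) ∧
      (∀ k, ∑ l, w k l = 1 / N) ∧ (∀ l, ∑ k, w k l = 1 / N) ∧
      ∑ k, ∑ l, w k l * c (x N k, y N l) ≤ ∫ z, c z ∂p + ε := by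
  have hint : ∀ (g : E × E → ℝ) (D : ℝ), Continuous g → (∀ z, 0 ≤ g z) → (∀ z, g z ≤ D) →
      Integrable g p := fun g D hg h0 hD =>
    Integrable.of_bound hg.aestronglyMeasurable D
      (Eventually.of_forall fun z => by rw [Real.norm_of_nonneg (h0 z)]; exact hD z)
  obtain ⟨z₀⟩ : Nonempty (E × E) := by
    by_contra hne
    rw [not_nonempty_iff] at hne
    have h1 := measure_univ (μ := p)
    rw [Set.univ_eq_empty_iff.2 hne, measure_empty] at h1
    exact zero_ne_one h1
  have hC0 : 0 ≤ C := (hc0 z₀).trans (hcC z₀)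
  obtain ⟨δ, hδ, hunif⟩ := Metric.uniformContinuousOn_iff.1
    ((hK.prod hK).uniformContinuousOn_of_continuous hc.continuousOn) (ε / 2) (half_pos hε)
  obtain ⟨m, f, hf0, hf1, hfsum, hfδ⟩ := exists_partition_of_small_diam hK hδ
  obtain ⟨lam, hlam0, hlam1, hlamC⟩ : ∃ lam : ℝ, 0 < lam ∧ lam < 1 ∧ (1 - lam) * C ≤ ε / 2 := by
    refine ⟨max (1 / 2) (1 - ε / (2 * (C + 1))), lt_max_of_lt_left (by norm_num),
      max_lt (by norm_num) (sub_lt_self _ (by positivity)), ?_⟩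
    have h1 : 1 - max (1 / 2) (1 - ε / (2 * (C + 1))) ≤ ε / (2 * (C + 1)) := by
      linarith [le_max_right (1 / 2) (1 - ε / (2 * (C + 1)))]
    calc (1 - max (1 / 2) (1 - ε / (2 * (C + 1)))) * C ≤ ε / (2 * (C + 1)) * (C + 1) :=
          mul_le_mul h1 (by linarith) hC0 (by positivity)
      _ = ε / 2 := by field_simp
  have hprod0 : ∀ i j (z : E × E), 0 ≤ f i z.1 * f j z.2 := fun i j z =>
    mul_nonneg (hf0 i _) (hf0 j _)
  have hprod1 : ∀ i j (z : E × E), f i z.1 * f j z.2 ≤ 1 := fun i j z =>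
    mul_le_one₀ (hf1 i _) (hf0 j _) (hf1 j _)
  have hprodc : ∀ i j, Continuous fun z : E × E => f i z.1 * f j z.2 := fun i j =>
    ((f i).continuous.comp continuous_fst).mul ((f j).continuous.comp continuous_snd)
  have hprodi : ∀ i j, Integrable (fun z : E × E => f i z.1 * f j z.2) p := fun i j =>
    hint _ 1 (hprodc i j) (hprod0 i j) (hprod1 i j)
  have hci : ∀ i j, Integrable (fun z : E × E => f i z.1 * f j z.2 * (c z + ε / 2)) p :=
    fun i j => hint _ (1 * (C + ε / 2)) ((hprodc i j).mul (hc.add continuous_const))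
      (fun z => mul_nonneg (hprod0 i j z) (add_nonneg (hc0 z) (half_pos hε).le))
      (fun z => mul_le_mul (hprod1 i j z) (by linarith [hcC z])
        (add_nonneg (hc0 z) (half_pos hε).le) zero_le_one)
  set P : Fin m → Fin m → ℝ := fun i j => ∫ z, f i z.1 * f j z.2 ∂p with hP
  set Q : Fin m → Fin m → ℝ := fun i j => ∫ z, f i z.1 * f j z.2 * (c z + ε / 2) ∂p with hQ
  have hrow : ∀ i, ∑ j, P i j = ∫ z, f i z ∂μ := by
    intro i
    rw [← hpμ, integral_map measurable_fst.aemeasurable (f i).continuous.aestronglyMeasurable,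
      ← integral_finsetSum _ fun j _ => hprodi i j]
    refine integral_congr_ae (hpK.mono fun z hz => ?_)
    simp only [← Finset.mul_sum, hfsum _ hz.2, mul_one]
  have hcol : ∀ j, ∑ i, P i j = ∫ z, f j z ∂ν := by
    intro j
    rw [← hpν, integral_map measurable_snd.aemeasurable (f j).continuous.aestronglyMeasurable,
      ← integral_finsetSum _ fun i _ => hprodi i j]
    refine integral_congr_ae (hpK.mono fun z hz => ?_)
    simp only [← Finset.sum_mul, hfsum _ hz.1, one_mul]
  have hsum : ∀ g : E × E → ℝ, (∀ i j, Integrable (fun z => f i z.1 * f j z.2 * g z) p) →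
      ∑ i, ∑ j, ∫ z, f i z.1 * f j z.2 * g z ∂p = ∫ z, g z ∂p := by
    intro g hg
    calc ∑ i, ∑ j, ∫ z, f i z.1 * f j z.2 * g z ∂p
        = ∑ i, ∫ z, ∑ j, f i z.1 * f j z.2 * g z ∂p :=
          Finset.sum_congr rfl fun i _ => (integral_finsetSum _ fun j _ => hg i j).symm
      _ = ∫ z, ∑ i, ∑ j, f i z.1 * f j z.2 * g z ∂p :=
          (integral_finsetSum _ fun i _ => integrable_finsetSum _ fun j _ => hg i j).symm
      _ = ∫ z, g z ∂p := integral_congr_ae (hpK.mono fun z hz => by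
          simp only [← Finset.sum_mul, ← Finset.mul_sum, hfsum _ hz.2, hfsum _ hz.1, mul_one,
            one_mul])
  have hP1 : ∑ i, ∑ j, P i j = 1 := by
    have := hsum (fun _ => 1) (by simpa using hprodi)
    simpa using this
  have hQ1 : ∑ i, ∑ j, Q i j = ∫ z, c z ∂p + ε / 2 := by
    have := hsum (fun z => c z + ε / 2) hci
    rw [this, integral_add (hint c C hc hc0 hcC) (integrable_const _)]
    simp
  filter_upwards [eventually_all.2 fun i => eventually_mul_integral_le_emp hx (hf0 i) (hf1 i) hlam1,
    eventually_all.2 fun i => eventually_mul_integral_le_emp hy (hf0 i) (hf1 i) hlam1,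
    eventually_gt_atTop 0] with N hN1 hN2 hN0
  have hNpos : (0 : ℝ) < N := by exact_mod_cast hN0
  have hsumx : ∀ k, ∑ i, f i (x N k) / N = 1 / N := fun k => by
    rw [← Finset.sum_div, hfsum _ (hxK N k)]
  have hsumy : ∀ k, ∑ i, f i (y N k) / N = 1 / N := fun k => by
    rw [← Finset.sum_div, hfsum _ (hyK N k)]
  obtain ⟨w, hw0, hw1, hw2, hw3⟩ := exists_transport_weights hlam0 hlam1 (P := P) (Q := Q)
    (fun i j => integral_nonneg (hprod0 i j))
    (fun i j => integral_nonneg fun z =>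
      mul_nonneg (hprod0 i j z) (add_nonneg (hc0 z) (half_pos hε).le)) hP1
    (α := fun i k => f i (x N k) / N) (β := fun i k => f i (y N k) / N)
    (fun i k => div_nonneg (hf0 _ _) hNpos.le) (fun i k => div_nonneg (hf0 _ _) hNpos.le)
    (by simp [hsumx, hNpos.ne']) (by simp [hsumy, hNpos.ne'])
    (fun i => by rw [hrow]; exact hN1 i) (fun j => by rw [hcol]; exact hN2 j)
    (c := fun k l => c (x N k, y N l)) (fun k l => hcC _) (by
      intro i j k l hi hj
      have hi' : 0 < f i (x N k) := (div_pos_iff_of_pos_right hNpos).1 hi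
      have hj' : 0 < f j (y N l) := (div_pos_iff_of_pos_right hNpos).1 hj
      rw [hP, hQ]
      simp only
      rw [← integral_mul_const]
      refine integral_mono_ae ((hprodi i j).mul_const _) (hci i j) (hpK.mono fun z hz => ?_)
      rcases (hf0 i z.1).eq_or_lt with h | h
      · simp [← h]
      rcases (hf0 j z.2).eq_or_lt with h' | h'
      · simp [← h']
      refine mul_le_mul_of_nonneg_left ?_ (hprod0 i j z)
      have hd : dist (x N k, y N l) z < δ := by
        rw [Prod.dist_eq]
        exact max_lt (hfδ i _ _ hi' h) (hfδ j _ _ hj' h')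
      have := hunif (x N k, y N l) ⟨hxK N k, hyK N l⟩ z hz hd
      rw [Real.dist_eq] at this
      linarith [(abs_lt.1 this).2])
  refine ⟨w, hw0, fun k => (hw1 k).trans (hsumx k), fun l => (hw2 l).trans (hsumy l), ?_⟩
  refine hw3.trans ?_
  rw [hQ1]
  linarith

theorem emp_apply_univ_le {X : Type*} [MeasurableSpace X] (N : ℕ) (x : Fin N → X) :
    emp N x Set.univ ≤ 1 := by
  simp [emp, ENNReal.inv_mul_le_one]

theorem isFiniteMeasure_emp {X : Type*} [MeasurableSpace X] (N : ℕ) (x : Fin N → X) :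
    IsFiniteMeasure (emp N x) :=
  ⟨(emp_apply_univ_le N x).trans_lt ENNReal.one_lt_top⟩

theorem emp_compl_eq_zero {X : Type*} [MeasurableSpace X] {K : Set X} (hK : MeasurableSet K)
    {N : ℕ} {x : Fin N → X} (hx : ∀ k, x k ∈ K) : emp N x Kᶜ = 0 := by
  simp [emp, Measure.dirac_apply' _ hK.compl, hx]

theorem ofReal_le_epos {r : ℝ} {x : EReal} (h : (r : EReal) ≤ x) : ENNReal.ofReal r ≤ epos x := by
  induction x with
  | bot => simp at h
  | top => simp [epos]
  | coe x =>
    have : r ≤ x := by exact_mod_cast h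
    simpa [epos] using ENNReal.ofReal_le_ofReal this

section Plans

variable {n : ℕ} {a b : ℝ} {L : Eu n → Eu n → ℝ} {c₁ c₂ : ℝ}

/-- Every plan between two empirical measures is realized by a probability measure on paths, at
a price arbitrarily close to the transport cost for `minCost`. -/
theorem exists_aFun_le_of_weights (hab : a < b) (hL : Continuous (Function.uncurry L))
    (hF : IsCoerciveFunctional (action (n := n) L a b) (c₂ * (b - a))) {N : ℕ} (hN : 0 < N)
    {x y : Fin N → Eu n} {w : Fin N → Fin N → ℝ} (hw : ∀ k l, 0 ≤ w k l)
    (hrow : ∀ k, ∑ l, w k l = 1 / N) (hcol : ∀ l, ∑ k, w k l = 1 / N) {E : ℝ}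
    (hE : ∑ k, ∑ l, w k l * minCost L (b - a) (x k) (y l) < E) :
    ∃ π : ProbabilityMeasure (CPath a b n),
      aFun (action L a b) (emp N x) (emp N y) (π : Measure (CPath a b n)) ≤ E := by
  set B := c₂ * (b - a) with hB
  set S := ∑ k, ∑ l, w k l * minCost L (b - a) (x k) (y l) with hS
  have hNpos : (0 : ℝ) < N := by exact_mod_cast hN
  have hw1 : ∑ k, ∑ l, w k l = 1 := by simp [hrow, hNpos.ne']
  have hex : ∀ k l, ∃ (A : ℝ) (γ : CPath a b n), A ≤ minCost L (b - a) (x k) (y l) + (E - S) ∧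
      pev γ a = x k ∧ pev γ b = y l ∧ action L a b γ = A := by
    intro k l
    obtain ⟨A, hA, hr⟩ := exists_reach_lt hL (sub_pos.2 hab)
      (lt_add_of_pos_right (minCost L (b - a) (x k) (y l)) (sub_pos.2 hE))
    obtain ⟨γ, h1, h2, h3⟩ := hr.exists_path hab.le
    exact ⟨A, γ, hA.le, h1, h2, h3⟩
  choose A γ hA hγa hγb hγA using hex
  set π : Measure (CPath a b n) := ∑ k, ∑ l, ENNReal.ofReal (w k l) • Measure.dirac (γ k l)
    with hπ
  have hNinv : ENNReal.ofReal (1 / N) = (N : ℝ≥0∞)⁻¹ := by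
    rw [one_div, ENNReal.ofReal_inv_of_pos hNpos, ENNReal.ofReal_natCast]
  have happly : ∀ s, MeasurableSet s →
      π s = ∑ k, ∑ l, ENNReal.ofReal (w k l) * s.indicator 1 (γ k l) := by
    intro s hs
    simp [hπ, Measure.dirac_apply' _ hs]
  have hprob : IsProbabilityMeasure π := ⟨by
    rw [happly _ MeasurableSet.univ]
    simp only [Set.indicator_univ, Pi.one_apply, mul_one]
    simp_rw [← ENNReal.ofReal_sum_of_nonneg fun l _ => hw _ l]
    rw [← ENNReal.ofReal_sum_of_nonneg fun k _ => Finset.sum_nonneg fun l _ => hw k l, hw1,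
      ENNReal.ofReal_one]⟩
  refine ⟨⟨π, hprob⟩, ?_⟩
  change aFun (action L a b) (emp N x) (emp N y) π ≤ E
  rw [hF.aFun_le_iff]
  have hAB : ∀ k l, 0 ≤ A k l + B := by
    intro k l
    have := hF.lower (γ k l)
    rw [hγA] at this
    have : -B ≤ A k l := by exact_mod_cast this
    linarith
  have hsum : ∑ k, ∑ l, w k l * (A k l + B) ≤ E + B := by
    calc ∑ k, ∑ l, w k l * (A k l + B)
        ≤ ∑ k, ∑ l, (w k l * minCost L (b - a) (x k) (y l) + w k l * (E - S + B)) := by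
          refine Finset.sum_le_sum fun k _ => Finset.sum_le_sum fun l _ => ?_
          rw [← mul_add]
          exact mul_le_mul_of_nonneg_left (by linarith [hA k l]) (hw k l)
      _ = S + (∑ k, ∑ l, w k l) * (E - S + B) := by
          simp_rw [Finset.sum_add_distrib, Finset.sum_mul]
          rfl
      _ = E + B := by rw [hw1]; ring
  refine ⟨⟨?_, ?_⟩, ?_, ?_⟩
  · ext s hs
    rw [Measure.map_apply (continuous_pev a).measurable hs,
      happly _ ((continuous_pev a).measurable hs)]
    have : ∀ k l, (((fun γ : CPath a b n => pev γ a) ⁻¹' s).indicator 1 (γ k l) : ℝ≥0∞) =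
        s.indicator 1 (x k) := by
      intro k l
      rw [← hγa k l]
      by_cases h : pev (γ k l) a ∈ s <;> simp [h]
    simp_rw [this, ← Finset.sum_mul, ← ENNReal.ofReal_sum_of_nonneg fun l _ => hw _ l, hrow, hNinv]
    simp [emp, Measure.dirac_apply' _ hs, Finset.mul_sum]
  · ext s hs
    rw [Measure.map_apply (continuous_pev b).measurable hs,
      happly _ ((continuous_pev b).measurable hs)]
    have : ∀ k l, (((fun γ : CPath a b n => pev γ b) ⁻¹' s).indicator 1 (γ k l) : ℝ≥0∞) =
        s.indicator 1 (y l) := by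
      intro k l
      rw [← hγb k l]
      by_cases h : pev (γ k l) b ∈ s <;> simp [h]
    rw [Finset.sum_comm]
    simp_rw [this, ← Finset.sum_mul, ← ENNReal.ofReal_sum_of_nonneg fun k _ => hw k _, hcol, hNinv]
    simp [emp, Measure.dirac_apply' _ hs, Finset.mul_sum]
  · exact le_trans (Finset.sum_nonneg fun k _ => Finset.sum_nonneg fun l _ =>
      mul_nonneg (hw k l) (hAB k l)) hsum
  · have hm : Measurable fun γ : CPath a b n => epos (action L a b γ + (B : EReal)) :=
      hF.lowerSemicontinuous_shift.measurable
    calc ∫⁻ γ, epos (action L a b γ + (B : EReal)) ∂π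
        = ∑ k, ∑ l, ENNReal.ofReal (w k l) * epos (action L a b (γ k l) + (B : EReal)) := by
          simp [hπ, lintegral_finsetSum_measure, lintegral_smul_measure, lintegral_dirac' _ hm]
      _ = ENNReal.ofReal (∑ k, ∑ l, w k l * (A k l + B)) := by
          rw [ENNReal.ofReal_sum_of_nonneg fun k _ => Finset.sum_nonneg fun l _ =>
            mul_nonneg (hw k l) (hAB k l)]
          refine Finset.sum_congr rfl fun k _ => ?_
          rw [ENNReal.ofReal_sum_of_nonneg fun l _ => mul_nonneg (hw k l) (hAB k l)]
          refine Finset.sum_congr rfl fun l _ => ?_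
          rw [hγA, ENNReal.ofReal_mul (hw k l), ← EReal.coe_add]
          simp [epos, -EReal.coe_add]
      _ ≤ ENNReal.ofReal (E + B) := ENNReal.ofReal_le_ofReal hsum

/-- The transport cost `minCost`, shifted to be nonnegative and capped at level `D`. -/
noncomputable def cappedCost (L : Eu n → Eu n → ℝ) (T B D : ℝ) (z : Eu n × Eu n) : ℝ :=
  min (minCost L T z.1 z.2 + B) D

theorem cappedCost_nonneg {T D : ℝ} (hL : Continuous (Function.uncurry L)) (hT : 0 < T)
    (hc₁ : 0 < c₁) (hL3 : ∀ x v : Eu n, c₁ * ‖v‖ - c₂ ≤ L x v) (hD : 0 ≤ D)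
    (z : Eu n × Eu n) : 0 ≤ cappedCost L T (c₂ * T) D z := by
  have h : -(c₂ * T) ≤ minCost L T z.1 z.2 := lower_bound_minCost hL hT hc₁ hL3
  exact le_min (by linarith) hD

theorem continuous_cappedCost {T : ℝ} (hL : Continuous (Function.uncurry L)) (hT : 0 < T)
    (hc₁ : 0 < c₁) (hc₂ : 0 < c₂) (hL3 : ∀ x v : Eu n, c₁ * ‖v‖ - c₂ ≤ L x v) (B D : ℝ) :
    Continuous (cappedCost L T B D) :=
  ((continuous_minCost hL hT hc₁ hc₂ hL3).add continuous_const).min continuous_const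

/-- Recovery plans: the cost of any coupling of the limiting marginals is asymptotically attained
by path measures with empirical marginals. -/
theorem eventually_exists_aFun_le (hab : a < b) (hL : Continuous (Function.uncurry L))
    (hc₁ : 0 < c₁) (hc₂ : 0 < c₂) (hL3 : ∀ x v : Eu n, c₁ * ‖v‖ - c₂ ≤ L x v)
    (hF : IsCoerciveFunctional (action (n := n) L a b) (c₂ * (b - a)))
    {K : Set (Eu n)} (hK : IsCompact K) {D : ℝ} (hD0 : 0 ≤ D)
    (hD : ∀ x ∈ K, ∀ y ∈ K, minCost L (b - a) x y + c₂ * (b - a) ≤ D)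
    {μ ν : Measure (Eu n)} {x y : (N : ℕ) → Fin N → Eu n} (hxK : ∀ N i, x N i ∈ K)
    (hyK : ∀ N i, y N i ∈ K) (hx : WeakLim (fun N => emp N (x N)) μ)
    (hy : WeakLim (fun N => emp N (y N)) ν) (p : Measure (Eu n × Eu n)) [IsProbabilityMeasure p]
    (hpμ : p.map Prod.fst = μ) (hpν : p.map Prod.snd = ν)
    (hpK : ∀ᵐ z ∂p, z.1 ∈ K ∧ z.2 ∈ K) {E : ℝ}
    (hE : ∫ z, cappedCost L (b - a) (c₂ * (b - a)) D z ∂p < E + c₂ * (b - a)) :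
    ∀ᶠ N : ℕ in atTop, ∃ π : ProbabilityMeasure (CPath a b n),
      aFun (action L a b) (emp N (x N)) (emp N (y N)) (π : Measure (CPath a b n)) ≤ E := by
  set B := c₂ * (b - a) with hB
  set c : Eu n × Eu n → ℝ := cappedCost L (b - a) B D with hc
  set ε := (E + B - ∫ z, c z ∂p) / 2 with hε
  have hT : 0 < b - a := sub_pos.2 hab
  have hcont : Continuous c := continuous_cappedCost hL hT hc₁ hc₂ hL3 B D
  filter_upwards [eventually_exists_transport_weights hK hxK hyK hx hy p hpμ hpν hpK hcont
    (cappedCost_nonneg hL hT hc₁ hL3 hD0)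
    (fun z => min_le_right _ _) (ε := ε) (by rw [hε]; linarith), eventually_gt_atTop 0]
    with N hN hN0
  obtain ⟨w, hw0, hw1, hw2, hw3⟩ := hN
  have hNpos : (0 : ℝ) < N := by exact_mod_cast hN0
  refine exists_aFun_le_of_weights hab hL hF hN0 hw0 hw1 hw2 ?_
  have hcK : ∀ k l, c (x N k, y N l) = minCost L (b - a) (x N k) (y N l) + B := fun k l =>
    min_eq_left (hD _ (hxK N k) _ (hyK N l))
  have hsum : ∑ k, ∑ l, w k l * c (x N k, y N l) =
      ∑ k, ∑ l, w k l * minCost L (b - a) (x N k) (y N l) + B := by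
    simp_rw [hcK, mul_add, Finset.sum_add_distrib, ← Finset.sum_mul, hw1]
    simp [hNpos.ne']
  linarith

/-- The capped transport cost of the endpoint coupling of a path measure is bounded by its
action. -/
theorem integral_cappedCost_le (hab : a < b) (hL : Continuous (Function.uncurry L))
    (hc₁ : 0 < c₁) (hc₂ : 0 < c₂) (hL3 : ∀ x v : Eu n, c₁ * ‖v‖ - c₂ ≤ L x v)
    (hF : IsCoerciveFunctional (action (n := n) L a b) (c₂ * (b - a))) {D : ℝ} (hD0 : 0 ≤ D)
    {μ ν : Measure (Eu n)} (π : Measure (CPath a b n)) [IsProbabilityMeasure π] {C : ℝ}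
    (hC : aFun (action L a b) μ ν π ≤ C) :
    ∫ z, cappedCost L (b - a) (c₂ * (b - a)) D z ∂(π.map fun γ => (pev γ a, pev γ b)) ≤
      C + c₂ * (b - a) := by
  obtain ⟨-, h0, h1⟩ := (hF.aFun_le_iff π).1 hC
  have hT : 0 < b - a := sub_pos.2 hab
  have hcont : Continuous (cappedCost (n := n) L (b - a) (c₂ * (b - a)) D) :=
    continuous_cappedCost hL hT hc₁ hc₂ hL3 _ D
  have hpc : Continuous fun γ : CPath a b n => (pev γ a, pev γ b) :=
    (continuous_pev a).prodMk (continuous_pev b)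
  rw [integral_map hpc.measurable.aemeasurable hcont.aestronglyMeasurable,
    integral_eq_lintegral_of_nonneg_ae (Eventually.of_forall fun γ =>
      cappedCost_nonneg hL hT hc₁ hL3 hD0 _)
      (hcont.comp hpc).aestronglyMeasurable]
  refine ENNReal.toReal_le_of_le_ofReal h0 ((lintegral_mono fun γ => ?_).trans h1)
  refine ofReal_le_epos ?_
  calc ((cappedCost L (b - a) (c₂ * (b - a)) D (pev γ a, pev γ b) : ℝ) : EReal)
      ≤ ((minCost L (b - a) (pev γ a) (pev γ b) + c₂ * (b - a) : ℝ) : EReal) := by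
        exact EReal.coe_le_coe_iff.2 (min_le_left _ _)
    _ ≤ _ := by
        rw [EReal.coe_add]
        gcongr
        exact minCost_le_action hab.le hc₁ hL3

end Plans

/-- **Convergence of minimizers (Corollary 3.3).**
The minimal values of `𝔸_{μ_a^{(N)},μ_b^{(N)}}` converge to the minimal value of
`𝔸_{μ_a,μ_b}`, and all infima are attained. Moreover every sequence of almost minimizers
admits a weakly convergent subsequence, and every weak limit of a subsequence of almost
minimizers is a minimizer of `𝔸_{μ_a,μ_b}`. -/
theorem convergence_of_minimizers
    {n : ℕ} (hn : 1 ≤ n) {a b : ℝ} (hab : a < b)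
    (L : Eu n → Eu n → ℝ)
    (hL1 : ContDiff ℝ (⊤ : ℕ∞) (Function.uncurry L))
    (hL2 : ∀ K : Set (Eu n), IsCompact K → ∃ c₀ : ℝ, 0 < c₀ ∧
      ∀ x ∈ K, ∀ v w : Eu n, c₀ * ‖w‖ ^ 2 ≤ fderiv ℝ (fderiv ℝ (L x)) v w w)
    (c₁ c₂ : ℝ) (hc₁ : 0 < c₁) (hc₂ : 0 < c₂)
    (hL3 : ∀ x v : Eu n, c₁ * ‖v‖ - c₂ ≤ L x v)
    (μa μb : Measure (Eu n)) [IsProbabilityMeasure μa] [IsProbabilityMeasure μb]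
    (hμaC : ∃ K : Set (Eu n), IsCompact K ∧ μa K = 1)
    (hμbC : ∃ K : Set (Eu n), IsCompact K ∧ μb K = 1)
    (hμaAC : μa ≪ volume) (hμbAC : μb ≪ volume)
    (x y : (N : ℕ) → Fin N → Eu n)
    (hxinj : ∀ N, Function.Injective (x N))
    (hsupp : ∃ K : Set (Eu n), IsCompact K ∧ ∀ N i, x N i ∈ K ∧ y N i ∈ K)
    (hxw : WeakLim (fun N => emp N (x N)) μa)
    (hyw : WeakLim (fun N => emp N (y N)) μb) :
    Tendsto
      (fun N => ⨅ π : ProbabilityMeasure (CPath a b n),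
        aFun (action L a b) (emp N (x N)) (emp N (y N)) (π : Measure (CPath a b n)))
      atTop
      (𝓝 (⨅ π : ProbabilityMeasure (CPath a b n),
        aFun (action L a b) μa μb (π : Measure (CPath a b n)))) ∧
    (∀ N, ∃ π : ProbabilityMeasure (CPath a b n),
      ∀ π' : ProbabilityMeasure (CPath a b n),
        aFun (action L a b) (emp N (x N)) (emp N (y N)) (π : Measure (CPath a b n)) ≤
          aFun (action L a b) (emp N (x N)) (emp N (y N)) (π' : Measure (CPath a b n))) ∧
    (∃ π : ProbabilityMeasure (CPath a b n),
      ∀ π' : ProbabilityMeasure (CPath a b n),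
        aFun (action L a b) μa μb (π : Measure (CPath a b n)) ≤
          aFun (action L a b) μa μb (π' : Measure (CPath a b n))) ∧
    (∀ πs : ℕ → ProbabilityMeasure (CPath a b n),
      Tendsto (fun N =>
          aFun (action L a b) (emp N (x N)) (emp N (y N)) (πs N : Measure (CPath a b n)))
        atTop
        (𝓝 (⨅ π : ProbabilityMeasure (CPath a b n),
          aFun (action L a b) μa μb (π : Measure (CPath a b n)))) →
      (∃ φ : ℕ → ℕ, StrictMono φ ∧ ∃ π : ProbabilityMeasure (CPath a b n),
        WeakLim (fun k => (πs (φ k) : Measure (CPath a b n))) (π : Measure (CPath a b n))) ∧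
      ∀ (φ : ℕ → ℕ), StrictMono φ → ∀ π : ProbabilityMeasure (CPath a b n),
        WeakLim (fun k => (πs (φ k) : Measure (CPath a b n))) (π : Measure (CPath a b n)) →
        ∀ π' : ProbabilityMeasure (CPath a b n),
          aFun (action L a b) μa μb (π : Measure (CPath a b n)) ≤
            aFun (action L a b) μa μb (π' : Measure (CPath a b n))) := by
  obtain ⟨Ks, hKs, hxy⟩ := hsupp
  obtain ⟨Ka, hKa, hμa⟩ := hμaC
  obtain ⟨Kb, hKb, hμb⟩ := hμbC
  set K := Ks ∪ (Ka ∪ Kb) with hKdef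
  have hK : IsCompact K := hKs.union (hKa.union hKb)
  have hxK : ∀ N i, x N i ∈ K := fun N i => Or.inl (hxy N i).1
  have hyK : ∀ N i, y N i ∈ K := fun N i => Or.inl (hxy N i).2
  have hμaK : μa Kᶜ = 0 := (prob_compl_eq_zero_iff hK.measurableSet).2
    (prob_le_one.antisymm (hμa ▸ measure_mono fun _ h => Or.inr (Or.inl h)))
  have hμbK : μb Kᶜ = 0 := (prob_compl_eq_zero_iff hK.measurableSet).2
    (prob_le_one.antisymm (hμb ▸ measure_mono fun _ h => Or.inr (Or.inr h)))
  have hempK : ∀ N, emp N (x N) Kᶜ = 0 := fun N => emp_compl_eq_zero hK.measurableSet (hxK N)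
  have hfinx := fun N => isFiniteMeasure_emp N (x N)
  have hfiny := fun N => isFiniteMeasure_emp N (y N)
  have hL : Continuous (Function.uncurry L) := hL1.continuous
  have hT : 0 < b - a := sub_pos.2 hab
  have hF : IsCoerciveFunctional (action (n := n) L a b) (c₂ * (b - a)) :=
    isCoerciveFunctional_action hab.le hL1 hL2 hc₁ hc₂.le hL3
  obtain ⟨D, hD0, hD⟩ : ∃ D : ℝ, 0 ≤ D ∧
      ∀ x ∈ K, ∀ y ∈ K, minCost L (b - a) x y + c₂ * (b - a) ≤ D := by
    obtain ⟨R, hR⟩ := hK.isBounded.exists_norm_le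
    obtain ⟨C, hC⟩ := exists_minCost_upper_bound hL hT hc₁ hL3 R
    exact ⟨max 0 (C + c₂ * (b - a)), le_max_left _ _, fun x hx y hy =>
      le_max_of_le_right (by linarith [hC x y (hR x hx) (hR y hy)])⟩
  set J : ℕ → EReal := fun N => ⨅ π : ProbabilityMeasure (CPath a b n),
    aFun (action L a b) (emp N (x N)) (emp N (y N)) (π : Measure (CPath a b n)) with hJ
  set I : EReal := ⨅ π : ProbabilityMeasure (CPath a b n),
    aFun (action L a b) μa μb (π : Measure (CPath a b n)) with hI
  have hlimit : ∀ (φ : ℕ → ℕ), StrictMono φ → ∀ (πs : ℕ → ProbabilityMeasure (CPath a b n)) (π),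
      Tendsto πs atTop (𝓝 π) → ∀ C : ℝ, (∀ᶠ k in atTop, aFun (action L a b) (emp (φ k) (x (φ k)))
        (emp (φ k) (y (φ k))) (πs k : Measure (CPath a b n)) ≤ C) →
      aFun (action L a b) μa μb (π : Measure (CPath a b n)) ≤ C := by
    intro φ hφ πs π hπ C hC
    obtain ⟨k₀, hk₀⟩ := eventually_atTop.1 hC
    have hsub : Tendsto (fun k => φ (k + k₀)) atTop atTop :=
      hφ.tendsto_atTop.comp (tendsto_add_atTop_nat k₀)
    exact hF.aFun_le_of_tendsto (μs := fun k => emp (φ (k + k₀)) (x (φ (k + k₀))))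
      (νs := fun k => emp (φ (k + k₀)) (y (φ (k + k₀)))) (fun f => (hxw f).comp hsub)
      (fun f => (hyw f).comp hsub) (hπ.comp (tendsto_add_atTop_nat k₀))
      fun k => hk₀ (k + k₀) (Nat.le_add_left _ _)
  have hlower : ∀ r : EReal, r < I → ∀ᶠ N in atTop, r < J N := by
    intro r hr
    by_contra hcon
    obtain ⟨r', hr1, hr2⟩ := EReal.lt_iff_exists_real_btwn.1 hr
    have hfreq : ∃ᶠ N in atTop, J N < r' :=
      (not_eventually.1 hcon).mono fun N hN => (not_lt.1 hN).trans_lt hr1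
    obtain ⟨φ, hφ, hφJ⟩ := extraction_of_frequently_atTop hfreq
    choose πs hπs using fun k => iInf_lt_iff.1 (hφJ k)
    obtain ⟨ψ, hψ, π, hπ⟩ := hF.exists_subseq_tendsto hK (μs := fun k => emp (φ k) (x (φ k)))
      (νs := fun k => emp (φ k) (y (φ k))) (fun k => hempK _) fun k => (hπs k).le
    have := hlimit (φ ∘ ψ) (hφ.comp hψ) _ π hπ r' (Eventually.of_forall fun k => (hπs (ψ k)).le)
    exact absurd ((iInf_le _ π).trans this) (not_le.2 hr2)
  have hupper : ∀ r : EReal, I < r → ∀ᶠ N in atTop, J N < r := by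
    intro r hr
    obtain ⟨π, hπ⟩ := iInf_lt_iff.1 hr
    obtain ⟨C, hC1, hC2⟩ := EReal.lt_iff_exists_real_btwn.1 hπ
    obtain ⟨E, hE1, hE2⟩ := EReal.lt_iff_exists_real_btwn.1 hC2
    have hCE : C < E := by exact_mod_cast hE1
    obtain ⟨⟨hma, hmb⟩, -⟩ := (hF.aFun_le_iff _).1 hC1.le
    have hma' := (continuous_pev (a := a) (b := b) (n := n) a).measurable
    have hmb' := (continuous_pev (a := a) (b := b) (n := n) b).measurable
    have hpair := hma'.prodMk hmb'
    have hp : IsProbabilityMeasure ((π : Measure (CPath a b n)).map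
        fun γ => (pev γ a, pev γ b)) := Measure.isProbabilityMeasure_map hpair.aemeasurable
    have hae : ∀ᵐ z ∂((π : Measure (CPath a b n)).map fun γ => (pev γ a, pev γ b)),
        z.1 ∈ K ∧ z.2 ∈ K := by
      refine (ae_map_iff (p := fun z : Eu n × Eu n => z.1 ∈ K ∧ z.2 ∈ K) hpair.aemeasurable
        ((measurable_fst hK.measurableSet).inter (measurable_snd hK.measurableSet))).2 ?_
      have h1 : ∀ᵐ γ ∂(π : Measure (CPath a b n)), pev γ a ∈ K :=
        ae_of_ae_map hma'.aemeasurable (p := fun z => z ∈ K) (by rw [hma]; exact hμaK)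
      have h2 : ∀ᵐ γ ∂(π : Measure (CPath a b n)), pev γ b ∈ K :=
        ae_of_ae_map hmb'.aemeasurable (p := fun z => z ∈ K) (by rw [hmb]; exact hμbK)
      exact h1.and h2
    have hcost := integral_cappedCost_le hab hL hc₁ hc₂ hL3 hF hD0 _ hC1.le
    filter_upwards [eventually_exists_aFun_le hab hL hc₁ hc₂ hL3 hF hK hD0 hD hxK hyK hxw hyw _
      (by rw [Measure.map_map measurable_fst hpair]; exact hma)
      (by rw [Measure.map_map measurable_snd hpair]; exact hmb) hae
      (hcost.trans_lt (show C + c₂ * (b - a) < E + c₂ * (b - a) by linarith))] with N hN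
    obtain ⟨πN, hπN⟩ := hN
    exact ((iInf_le _ πN).trans hπN).trans_lt hE2
  have hI_top : I < ⊤ := by
    rw [lt_top_iff_ne_top]
    intro htop
    set E := ∫ z, cappedCost L (b - a) (c₂ * (b - a)) D z ∂(μa.prod μb) - c₂ * (b - a) + 1
    have hae : ∀ᵐ z ∂(μa.prod μb), z.1 ∈ K ∧ z.2 ∈ K := by
      have h1 : ∀ᵐ z ∂(μa.prod μb), z.1 ∈ K :=
        Measure.quasiMeasurePreserving_fst.ae (p := fun z => z ∈ K) hμaK
      have h2 : ∀ᵐ z ∂(μa.prod μb), z.2 ∈ K :=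
        Measure.quasiMeasurePreserving_snd.ae (p := fun z => z ∈ K) hμbK
      exact h1.and h2
    have hev := eventually_exists_aFun_le hab hL hc₁ hc₂ hL3 hF hK hD0 hD hxK hyK hxw hyw
      (μa.prod μb) (by simp) (by simp) hae (E := E) (by simp only [E]; linarith)
    obtain ⟨N, ⟨πN, hπN⟩, hN⟩ :=
      (hev.and (hlower E (by rw [htop]; exact EReal.coe_lt_top E))).exists
    exact absurd ((iInf_le _ πN).trans hπN) (not_le.2 hN)
  refine ⟨tendsto_order.2 ⟨hlower, hupper⟩, fun N => hF.exists_minimizer hK (hempK N),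
    hF.exists_minimizer hK hμaK, fun πs hπs => ⟨?_, fun φ hφ π hπ π' => ?_⟩⟩
  · obtain ⟨C, hC, -⟩ := EReal.lt_iff_exists_real_btwn.1 hI_top
    obtain ⟨N₀, hN₀⟩ := eventually_atTop.1 (hπs.eventually_lt_const hC)
    obtain ⟨φ, hφ, π, hπ⟩ := hF.exists_subseq_tendsto hK (πs := fun k => πs (k + N₀))
      (μs := fun k => emp (k + N₀) (x (k + N₀))) (νs := fun k => emp (k + N₀) (y (k + N₀)))
      (fun k => hempK _) fun k => (hN₀ (k + N₀) (Nat.le_add_left _ _)).le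
    exact ⟨fun k => φ k + N₀, fun i j hij => Nat.add_lt_add_right (hφ hij) N₀, π,
      weakLim_iff_tendsto.2 hπ⟩
  · refine le_trans (b := I) ?_ (iInf_le (fun π : ProbabilityMeasure (CPath a b n) =>
      aFun (action L a b) μa μb (π : Measure (CPath a b n))) π')
    refine EReal.le_of_forall_lt_iff_le.1 fun C hC => ?_
    exact hlimit φ hφ (fun k => πs (φ k)) π (weakLim_iff_tendsto.1 hπ) C
      (((hπs.comp hφ.tendsto_atTop).eventually_lt_const hC).mono fun k hk => le_of_lt hk)
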